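/- Fix a real constant C > 0 and an integer d ≥ 1. There are only finitely many subfields K of ℝ that are totally real number fields of degree d satisfying U_K(2) < C. -/

import Mathlib

open scoped TensorProduct

noncomputable section

open NumberField

structure OKLattice (K : Type) [Field K] : Type 1 where
  carrier : Type
  [addCommGroup : AddCommGroup carrier]
  [module : Module (𝓞 K) carrier]
  [finite : Module.Finite (𝓞 K) carrier]
  [torsionFree : NoZeroSMulDivisors (𝓞 K) carrier]
  form : carrier →ₗ[𝓞 K] carrier →ₗ[𝓞 K] 𝓞 K
  symm : ∀ x y, form x y = form y x
  posDef : ∀ v : carrier, v ≠ 0 → ∀ σ : K →+* ℝ, 0 < σ (algebraMap (𝓞 K) K (form v v))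

attribute [instance] OKLattice.addCommGroup OKLattice.module OKLattice.finite
  OKLattice.torsionFree

namespace OKLattice

variable {K : Type} [Field K]

/-- The rank of an `O_K`-lattice: the `K`-dimension of `L ⊗ K`. -/
def rank (L : OKLattice K) : ℕ :=
  Module.finrank K (K ⊗[𝓞 K] L.carrier)

/-- `L.Represents L'` : `L'` is represented by `L`. -/
def Represents (L L' : OKLattice K) : Prop :=
  ∃ σ : L'.carrier →ₗ[𝓞 K] L.carrier, ∀ x, L.form (σ x) (σ x) = L'.form x x

/-- `L` is `n`-universal. -/
def IsUniversal (L : OKLattice K) (n : ℕ) : Prop :=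
  ∀ L' : OKLattice K, L'.rank = n → L.Represents L'

end OKLattice

/-- `U_K(n)`: the minimal rank of an `n`-universal `O_K`-lattice. -/
def minUnivRank (K : Type) [Field K] (n : ℕ) : ℕ :=
  sInf {m | ∃ L : OKLattice K, L.IsUniversal n ∧ L.rank = m}

/-- `K` is totally real: every embedding into `ℂ` has image contained in `ℝ`. -/
def TotallyReal (K : Type) [Field K] : Prop :=
  ∀ φ : K →+* ℂ, ∀ x : K, (φ x).im = 0

namespace TotallyReal

variable {K : Type} [Field K]

lemma exists_real_embedding (hK : TotallyReal K) (φ : K →+* ℂ) :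
    ∃ s : K →+* ℝ, Complex.ofRealHom.comp s = φ := by
  refine ⟨{ toFun := fun x => (φ x).re, map_one' := by simp, map_zero' := by simp,
            map_add' := by simp, map_mul' := fun x y => by simp [hK φ x] }, ?_⟩
  ext x
  exact Complex.ext (by simp) (by simp [hK φ x])

/-- Real embeddings of a totally real field correspond to complex ones. -/
def embeddingEquiv (hK : TotallyReal K) : (K →+* ℝ) ≃ (K →+* ℂ) :=
  Equiv.ofBijective (fun s => Complex.ofRealHom.comp s)
    ⟨fun s t h => RingHom.ext fun x => by simpa using RingHom.congr_fun h x,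
      fun φ => hK.exists_real_embedding φ⟩

lemma embeddingEquiv_apply (hK : TotallyReal K) (s : K →+* ℝ) (x : K) :
    hK.embeddingEquiv s x = (s x : ℂ) := rfl

variable [NumberField K]

lemma norm_eq_prod (hK : TotallyReal K) (x : K) :
    ((Algebra.norm ℚ x : ℚ) : ℝ) = ∏ s : K →+* ℝ, s x := by
  have h := Algebra.norm_eq_prod_embeddings ℚ ℂ x
  rw [← (RingHom.equivRatAlgHom (R := K) (S := ℂ)).prod_comp, ← hK.embeddingEquiv.prod_comp] at h
  have h' : (((Algebra.norm ℚ x : ℚ) : ℝ) : ℂ) = ((∏ s : K →+* ℝ, s x : ℝ) : ℂ) := by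
    push_cast
    simpa [embeddingEquiv_apply] using h
  exact_mod_cast h'

lemma trace_eq_sum (hK : TotallyReal K) (x : K) :
    ((Algebra.trace ℚ K x : ℚ) : ℝ) = ∑ s : K →+* ℝ, s x := by
  have h := trace_eq_sum_embeddings (K := ℚ) ℂ (x := x)
  rw [← (RingHom.equivRatAlgHom (R := K) (S := ℂ)).sum_comp, ← hK.embeddingEquiv.sum_comp] at h
  have h' : (((Algebra.trace ℚ K x : ℚ) : ℝ) : ℂ) = ((∑ s : K →+* ℝ, s x : ℝ) : ℂ) := by
    push_cast
    simpa [embeddingEquiv_apply] using h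
  exact_mod_cast h'

lemma nonempty_embedding (hK : TotallyReal K) : Nonempty (K →+* ℝ) :=
  hK.embeddingEquiv.nonempty

lemma finite_bounded (hK : TotallyReal K) {H : ℕ} (hH : H ≠ 0) (B : ℝ) :
    {x : K | IsIntegral ℤ ((H : K) * x) ∧ ∀ s : K →+* ℝ, |s x| ≤ B}.Finite := by
  refine Set.Finite.subset ((NumberField.Embeddings.finite_of_norm_le K ℂ (H * B)).preimage
    (f := fun x => (H : K) * x)
    (mul_right_injective₀ (Nat.cast_ne_zero.mpr hH)).injOn) ?_
  rintro x ⟨hx, hb⟩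
  refine ⟨hx, fun φ => ?_⟩
  obtain ⟨s, rfl⟩ := hK.exists_real_embedding φ
  have := mul_le_mul_of_nonneg_left (hb s) (Nat.cast_nonneg (α := ℝ) H)
  simpa using this

lemma finite_bounded_integers (hK : TotallyReal K) (B : ℝ) :
    {x : 𝓞 K | ∀ s : K →+* ℝ, |s x| ≤ B}.Finite := by
  refine ((hK.finite_bounded one_ne_zero B).preimage
    (f := fun x : 𝓞 K => (x : K)) RingOfIntegers.coe_injective.injOn).subset fun x hx => ?_
  exact ⟨by simpa using x.isIntegral_coe, hx⟩

lemma exists_coord_bound (hK : TotallyReal K) :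
    ∃ ρ : ℝ, 0 < ρ ∧ ∀ (x : K) (M : ℝ), (∀ s : K →+* ℝ, |s x| ≤ M) →
      ∀ k, |((integralBasis K).repr x k : ℝ)| ≤ ρ * M := by
  classical
  set ω := integralBasis K with hω
  refine ⟨1 + ∑ k, ∑ s : K →+* ℝ, |s (ω.traceDual k)|, by positivity, fun x M hM k => ?_⟩
  have h0 : 0 ≤ M := (abs_nonneg _).trans (hM hK.nonempty_embedding.some)
  have h1 : ω.repr x k = Algebra.trace ℚ K (x * ω.traceDual k) := by
    rw [← Algebra.traceForm_apply, ← Module.Basis.traceDual_repr_apply]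
    simp
  rw [h1, hK.trace_eq_sum]
  calc |∑ s : K →+* ℝ, s (x * ω.traceDual k)|
      ≤ ∑ s : K →+* ℝ, |s (x * ω.traceDual k)| := Finset.abs_sum_le_sum_abs _ _
    _ ≤ ∑ s : K →+* ℝ, |s (ω.traceDual k)| * M := by
        refine Finset.sum_le_sum fun s _ => ?_
        rw [map_mul, abs_mul, mul_comm]
        exact mul_le_mul_of_nonneg_left (hM s) (abs_nonneg _)
    _ ≤ (1 + ∑ k, ∑ s : K →+* ℝ, |s (ω.traceDual k)|) * M := by
        rw [← Finset.sum_mul]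
        refine mul_le_mul_of_nonneg_right ?_ h0
        have := Finset.single_le_sum (f := fun k => ∑ s : K →+* ℝ, |s (ω.traceDual k)|)
          (fun i _ => by positivity) (Finset.mem_univ k)
        linarith


end TotallyReal

namespace TotallyReal

variable {K : Type} [Field K] [NumberField K]

open scoped Classical in
lemma exists_unit_log_near (y : Units.dirichletUnitTheorem.logSpace K) :
    ∃ u : (𝓞 K)ˣ, ‖y - Units.logEmbedding K (Additive.ofMul u)‖ ≤
      ∑ i, ‖(Units.basisUnitLattice K).ofZLatticeBasis ℝ (Units.unitLattice K) i‖ := by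
  set b := (Units.basisUnitLattice K).ofZLatticeBasis ℝ (Units.unitLattice K) with hb
  have h1 : (ZSpan.floor b y : Units.dirichletUnitTheorem.logSpace K) ∈ Units.unitLattice K := by
    rw [← (Units.basisUnitLattice K).ofZLatticeBasis_span ℝ (L := Units.unitLattice K)]
    exact (ZSpan.floor b y).2
  obtain ⟨u, -, hu⟩ := Submodule.mem_map.mp h1
  refine ⟨u.toMul, ?_⟩
  have h2 := ZSpan.norm_fract_le b y
  rw [ZSpan.fract_apply, ← hu] at h2
  exact h2

open scoped Classical in
lemma exists_unit_sq_balanced (hK : TotallyReal K) :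
    ∃ κ : ℝ, 1 ≤ κ ∧ ∀ α : K, (∀ s : K →+* ℝ, 0 < s α) →
      ∃ u : (𝓞 K)ˣ, ∀ s t : K →+* ℝ,
        s ((u : K) ^ 2 * α) ≤ κ * t ((u : K) ^ 2 * α) := by
  set R := ∑ i, ‖(Units.basisUnitLattice K).ofZLatticeBasis ℝ (Units.unitLattice K) i‖ with hR
  have hR0 : 0 ≤ R := Finset.sum_nonneg fun _ _ => norm_nonneg _
  set n : ℝ := (Fintype.card (InfinitePlace K) : ℝ) with hn
  have hn1 : 1 ≤ n := by
    rw [hn]; exact_mod_cast Fintype.card_pos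
  have hmult : ∀ w : InfinitePlace K, w.mult = 1 := fun w => by
    refine InfinitePlace.IsReal.mult_eq_one ?_
    obtain ⟨s, hs⟩ := hK.exists_real_embedding w.embedding
    refine ⟨w.embedding, ?_, w.mk_embedding⟩
    rw [ComplexEmbedding.isReal_iff]
    ext x
    rw [← hs]
    simp [ComplexEmbedding.conjugate]
  refine ⟨Real.exp (4 * (n * R)), Real.one_le_exp (by positivity), fun α hα => ?_⟩
  have hα0 : α ≠ 0 := by
    rintro rfl
    simpa using hα hK.nonempty_embedding.some
  set f : InfinitePlace K → ℝ := fun w => Real.log (w α) with hf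
  set c : ℝ := (∑ w, f w) / n with hc
  have hsum : ∑ w, (f w - c) / 2 = 0 := by
    rw [← Finset.sum_div, Finset.sum_sub_distrib]
    simp only [Finset.sum_const, Finset.card_univ, nsmul_eq_mul, ← hn, hc]
    field_simp
    simp
  obtain ⟨u, hu⟩ := exists_unit_log_near (K := K) (fun w => (f w.1 - c) / 2)
  rw [← hR, pi_norm_le_iff_of_nonneg hR0] at hu
  have hu' : ∀ w : {w : InfinitePlace K // w ≠ Units.dirichletUnitTheorem.w₀},
      |(f w.1 - c) / 2 - Real.log (w.1 (u : K))| ≤ R := fun w => by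
    simpa [Units.dirichletUnitTheorem.logEmbedding_component, hmult] using hu w
  have hlogsum : ∑ w : InfinitePlace K, Real.log (w (u : K)) = 0 := by
    simpa [hmult] using Units.sum_mult_mul_log u
  have key : ∀ w : InfinitePlace K, |(f w - c) / 2 - Real.log (w (u : K))| ≤ n * R := by
    intro w
    by_cases hw : w = Units.dirichletUnitTheorem.w₀
    · have h0 : ∑ w : InfinitePlace K, ((f w - c) / 2 - Real.log (w (u : K))) = 0 := by
        rw [Finset.sum_sub_distrib, hsum, hlogsum, sub_zero]
      rw [Fintype.sum_eq_add_sum_subtype_ne _ Units.dirichletUnitTheorem.w₀, ← hw] at h0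
      rw [eq_neg_of_add_eq_zero_left h0, abs_neg]
      refine (Finset.abs_sum_le_sum_abs _ _).trans ?_
      calc _ ≤ ∑ _w : {w' : InfinitePlace K // w' ≠ w}, R := by
            refine Finset.sum_le_sum fun w' _ => ?_
            exact hu' ⟨w'.1, hw ▸ w'.2⟩
        _ ≤ n * R := by
            rw [Finset.sum_const, Finset.card_univ, nsmul_eq_mul]
            refine mul_le_mul_of_nonneg_right ?_ hR0
            rw [hn]
            exact_mod_cast Fintype.card_subtype_le _
    · refine (hu' ⟨w, hw⟩).trans ?_
      nlinarith
  have hval : ∀ s : K →+* ℝ, 0 < s (((u⁻¹ : (𝓞 K)ˣ) : K) ^ 2 * α) := fun s => by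
    rw [map_mul, map_pow]
    have : s ((u⁻¹ : (𝓞 K)ˣ) : K) ≠ 0 := by
      simp
    have := hα s
    positivity
  have hlog : ∀ s : K →+* ℝ,
      |Real.log (s (((u⁻¹ : (𝓞 K)ˣ) : K) ^ 2 * α)) - c| ≤ 2 * (n * R) := fun s => by
    have h1 := key (InfinitePlace.mk (Complex.ofRealHom.comp s))
    have h2 : ∀ x : K, (InfinitePlace.mk (Complex.ofRealHom.comp s)) x = |s x| := fun x => by
      rw [InfinitePlace.apply]; simp
    rw [hf] at h1
    simp only [h2, Real.log_abs] at h1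
    have h3 : s ((u⁻¹ : (𝓞 K)ˣ) : K) = (s (u : K))⁻¹ := by
      rw [← map_inv₀]; congr 1
      simp
    have hu0 : s (u : K) ≠ 0 := by simp
    rw [map_mul, map_pow, h3, Real.log_mul (by positivity) (hα s).ne', Real.log_pow, Real.log_inv]
    rw [abs_le] at h1 ⊢
    push_cast
    constructor <;> linarith [h1.1, h1.2]
  refine ⟨u⁻¹, fun s t => ?_⟩
  rw [← Real.log_le_log_iff (hval s) (mul_pos (Real.exp_pos _) (hval t)),
    Real.log_mul (Real.exp_pos _).ne' (hval t).ne', Real.log_exp]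
  have h1 := abs_le.mp (hlog s)
  have h2 := abs_le.mp (hlog t)
  linarith [h1.1, h1.2, h2.1, h2.2]

lemma exists_basis_bound :
    ∃ Ω : ℝ, 1 ≤ Ω ∧ ∀ (f : Module.Free.ChooseBasisIndex ℤ (𝓞 K) → ℝ) (ε : ℝ), 0 ≤ ε →
      (∀ k, |f k| ≤ ε) → ∀ s : K →+* ℝ, |∑ k, f k * s (integralBasis K k)| ≤ Ω * ε := by
  refine ⟨1 + ∑ k, ∑ s : K →+* ℝ, |s (integralBasis K k)|,
    le_add_of_nonneg_right (by positivity), fun f ε hε hf s => ?_⟩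
  calc |∑ k, f k * s (integralBasis K k)|
      ≤ ∑ k, |f k * s (integralBasis K k)| := Finset.abs_sum_le_sum_abs _ _
    _ ≤ ∑ k, (∑ s : K →+* ℝ, |s (integralBasis K k)|) * ε := by
        refine Finset.sum_le_sum fun k _ => ?_
        rw [abs_mul, mul_comm]
        refine mul_le_mul ?_ (hf k) (abs_nonneg _) (by positivity)
        exact Finset.single_le_sum (f := fun s : K →+* ℝ => |s (integralBasis K k)|)
          (fun _ _ => abs_nonneg _) (Finset.mem_univ s)
    _ ≤ _ := by
        rw [← Finset.sum_mul]
        exact mul_le_mul_of_nonneg_right (by linarith) hε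

lemma map_eq_sum_repr (s : K →+* ℝ) (x : K) :
    s x = ∑ k, ((integralBasis K).repr x k : ℝ) * s (integralBasis K k) := by
  conv_lhs => rw [← (integralBasis K).sum_repr x]
  simp [map_sum, Algebra.smul_def]

lemma repr_intCombination (f : Module.Free.ChooseBasisIndex ℤ (𝓞 K) → ℤ)
    (k : Module.Free.ChooseBasisIndex ℤ (𝓞 K)) :
    (integralBasis K).repr (∑ k, f k • RingOfIntegers.basis K k : 𝓞 K) k = f k := by
  classical
  have h : ((∑ k, f k • RingOfIntegers.basis K k : 𝓞 K) : K)
      = ∑ k, (f k : ℚ) • integralBasis K k := by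
    simp [map_sum, integralBasis_apply, Algebra.smul_def]
  rw [h, (integralBasis K).repr_sum_self]

/-- Dirichlet approximation in a number field by multiples of bounded size. -/
lemma exists_multiple_near_integer {η : ℝ} (hη : 0 < η) :
    ∃ T : ℕ, 1 ≤ T ∧ ∀ θ : K, ∃ r : ℕ, 1 ≤ r ∧ r ≤ T ∧ ∃ o : 𝓞 K,
      ∀ s : K →+* ℝ, |s (r * θ - o)| ≤ η := by
  classical
  obtain ⟨Ω, hΩ, h⟩ := exists_basis_bound (K := K)
  obtain ⟨m, hm⟩ := exists_nat_gt (Ω / η)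
  have hm0 : (0 : ℝ) < m := lt_trans (by positivity) hm
  have hm0' : 0 < m := by exact_mod_cast hm0
  let ι := Module.Free.ChooseBasisIndex ℤ (𝓞 K)
  refine ⟨Fintype.card (ι → Fin m), ?_, fun θ => ?_⟩
  · have : Nonempty (Fin m) := ⟨⟨0, hm0'⟩⟩
    exact Fintype.card_pos
  set x := (integralBasis K).repr θ with hx
  have hbox : ∀ (j : ℕ) (k : ι), ⌊m * Int.fract (j * x k)⌋₊ < m := fun j k => by
    rw [Nat.floor_lt (mul_nonneg (Nat.cast_nonneg _) (Int.fract_nonneg _))]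
    have := Int.fract_lt_one ((j : ℚ) * x k)
    have hmq : (0 : ℚ) < m := by exact_mod_cast hm0'
    nlinarith
  obtain ⟨j, hj, j', hj', hne, hjj⟩ := Finset.exists_ne_map_eq_of_card_lt_of_maps_to
    (s := Finset.range (Fintype.card (ι → Fin m) + 1)) (t := Finset.univ)
    (f := fun j => (fun k => (⟨⌊m * Int.fract (j * x k)⌋₊, hbox j k⟩ : Fin m)))
    (by rw [Finset.card_univ, Finset.card_range]; exact Nat.lt_succ_self _)
    (fun _ _ => Finset.mem_coe.mpr (Finset.mem_univ _))
  wlog hlt : j < j' generalizing j j'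
  · exact this j' hj' j hj hne.symm hjj.symm (lt_of_le_of_ne (not_lt.mp hlt) hne.symm)
  refine ⟨j' - j, by omega, by rw [Finset.mem_range] at hj'; omega, ∑ k, (⌊j' * x k⌋ - ⌊j * x k⌋) •
    RingOfIntegers.basis K k, fun s => ?_⟩
  rw [map_eq_sum_repr]
  refine (h _ (1 / m) (by positivity) (fun k => ?_) s).trans ?_
  · have e1 : (integralBasis K).repr (((j' - j : ℕ) : K) * θ) k = (j' - j) * x k := by
      have : ((j' - j : ℕ) : K) * θ = ((j' : ℚ) - j) • θ := by
        rw [Nat.cast_sub hlt.le, Algebra.smul_def]; simp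
      rw [this]; simp [hx]
    rw [map_sub, Finsupp.sub_apply, e1]
    have e2 := repr_intCombination (K := K) (fun k => ⌊j' * x k⌋ - ⌊j * x k⌋) k
    rw [e2]
    have e3 := congrFun hjj k
    simp only [Fin.mk.injEq] at e3
    have hn : ∀ i : ℕ, (0 : ℚ) ≤ m * Int.fract (i * x k) := fun i =>
      mul_nonneg (Nat.cast_nonneg _) (Int.fract_nonneg _)
    have a1 := Nat.floor_le (hn j)
    have a2 := Nat.lt_floor_add_one (m * Int.fract ((j : ℚ) * x k))
    have a3 := Nat.floor_le (hn j')
    have a4 := Nat.lt_floor_add_one (m * Int.fract ((j' : ℚ) * x k))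
    rw [e3] at a1 a2
    have hmq : (0 : ℚ) < m := by exact_mod_cast hm0'
    have : |((j' : ℚ) - j) * x k - ((⌊j' * x k⌋ - ⌊j * x k⌋ : ℤ) : ℚ)| ≤ 1 / m := by
      have e4 : ((j' : ℚ) - j) * x k - ((⌊j' * x k⌋ - ⌊j * x k⌋ : ℤ) : ℚ)
          = Int.fract (j' * x k) - Int.fract (j * x k) := by
        rw [Int.fract, Int.fract]; push_cast; ring
      rw [e4, le_div_iff₀ hmq]
      rw [← abs_of_pos hmq, ← abs_mul, abs_le]
      constructor <;> nlinarith
    have h' : ((|((j' : ℚ) - j) * x k - ((⌊j' * x k⌋ - ⌊j * x k⌋ : ℤ) : ℚ)| : ℚ) : ℝ)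
        ≤ ((1 / m : ℚ) : ℝ) := by exact_mod_cast this
    push_cast at h' ⊢
    exact h'
  · rw [div_lt_iff₀ hη] at hm
    rw [mul_one_div, div_le_iff₀ hm0]
    linarith

end TotallyReal

namespace TotallyReal

variable {K : Type} [Field K]

lemma mul_mem_span_nnrat [CharZero K] {S : Set K} {c : ℚ} (hc : 0 ≤ c) {x : K}
    (hx : x ∈ Submodule.span ℚ≥0 S) : (c : K) * x ∈ Submodule.span ℚ≥0 S := by
  lift c to ℚ≥0 using hc
  have := Submodule.smul_mem (Submodule.span ℚ≥0 S) c hx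
  rwa [NNRat.smul_def, ← Rat.cast_nnratCast] at this

variable [NumberField K]

lemma exists_cone_generators (hK : TotallyReal K) {κ : ℝ} (hκ : 1 ≤ κ) :
    ∃ G : Set (𝓞 K), G.Finite ∧ (∀ g ∈ G, ∀ s : K →+* ℝ, 0 < s g) ∧
      ∀ α : K, (∀ s : K →+* ℝ, 0 < s α) → (∀ s t : K →+* ℝ, s α ≤ κ * t α) →
        α ∈ Submodule.span ℚ≥0 ((fun g : 𝓞 K => (g : K)) '' G) := by
  classical
  obtain ⟨Ω, hΩ, hbd⟩ := exists_basis_bound (K := K)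
  let ι := Module.Free.ChooseBasisIndex ℤ (𝓞 K)
  have hω : ∀ (k : ι) (s : K →+* ℝ), |s (integralBasis K k)| ≤ Ω := fun k s => by
    have := hbd (Pi.single k 1) 1 zero_le_one (fun i => by
      rw [Pi.single_apply]; split_ifs <;> simp) s
    simpa [Pi.single_apply] using this
  set n : ℝ := (Fintype.card (K →+* ℝ) : ℝ) with hn
  have hn1 : 1 ≤ n := by
    have := hK.nonempty_embedding
    rw [hn]; exact_mod_cast Fintype.card_pos
  have hnκ : 1 ≤ n * κ := by nlinarith
  obtain ⟨P, hP⟩ := exists_nat_gt (2 * (n * κ) * Ω)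
  obtain ⟨m, hm⟩ := exists_nat_gt (P * Fintype.card ι + 2 * (n * κ) * Ω)
  have hP0 : (0 : ℝ) < P := lt_trans (by positivity) hP
  have hm0 : (0 : ℝ) < m := lt_of_le_of_lt (by positivity) hm
  set B : ℝ := (P + 1) * (m + Ω) + m * Ω with hB
  refine ⟨{g : 𝓞 K | (∀ s : K →+* ℝ, 0 < s g) ∧ ∀ s : K →+* ℝ, |s g| ≤ B},
    (hK.finite_bounded_integers B).subset fun g hg => hg.2, fun g hg => hg.1,
    fun α hα hακ => ?_⟩
  set A : ℚ := Algebra.trace ℚ K α with hA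
  have hAsum : (A : ℝ) = ∑ s : K →+* ℝ, s α := hK.trace_eq_sum α
  have hA1 : ∀ s : K →+* ℝ, s α ≤ A := fun s => by
    rw [hAsum]
    exact Finset.single_le_sum (f := fun s : K →+* ℝ => s α) (fun t _ => (hα t).le)
      (Finset.mem_univ s)
  have hA2 : ∀ s : K →+* ℝ, A ≤ n * κ * s α := fun s => by
    rw [hAsum]
    refine (Finset.sum_le_card_nsmul _ _ (κ * s α) fun t _ => hακ t s).trans ?_
    rw [Finset.card_univ, nsmul_eq_mul, mul_assoc]
  have hA0 : (0 : ℝ) < A := (hα _).trans_le (hA1 hK.nonempty_embedding.some)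
  have hA0' : 0 < A := by exact_mod_cast hA0
  set x : K := m * (α / A) with hx
  have hsx : ∀ s : K →+* ℝ, s x = m * (s α / A) := fun s => by simp [hx]
  set fr : ι → ℚ := fun k => Int.fract ((integralBasis K).repr x k) with hfr
  have hfr0 : ∀ k, 0 ≤ fr k := fun k => Int.fract_nonneg _
  have hfr1 : ∀ k, fr k ≤ 1 := fun k => (Int.fract_lt_one _).le
  set g₀ : 𝓞 K := ∑ k, ⌊(integralBasis K).repr x k⌋ • RingOfIntegers.basis K k with hg₀
  have hxg : x = g₀ + ∑ k, (fr k : K) * integralBasis K k := by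
    conv_lhs => rw [← (integralBasis K).sum_repr x]
    have hg₁ : (g₀ : K) = ∑ k, (⌊(integralBasis K).repr x k⌋ : K) * integralBasis K k := by
      simp [hg₀, map_sum, integralBasis_apply]
    rw [hg₁, ← Finset.sum_add_distrib]
    refine Finset.sum_congr rfl fun k _ => ?_
    simp only [hfr, Int.fract, Algebra.smul_def, eq_ratCast]
    push_cast
    ring
  have hsg : ∀ s : K →+* ℝ, |s x - s g₀| ≤ Ω := fun s => by
    have h1 := hbd (fun k => fr k) 1 zero_le_one (fun k => by
      rw [abs_of_nonneg (by exact_mod_cast hfr0 k)]; exact_mod_cast hfr1 k) s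
    have h2 : s x - s g₀ = ∑ k, (fr k : ℝ) * s (integralBasis K k) := by
      rw [hxg]; simp
    rw [h2]; linarith
  have hsg_low : ∀ s : K →+* ℝ, m / (2 * (n * κ)) < s g₀ := fun s => by
    have h1 := (abs_le.mp (hsg s)).2
    have h2 : (1 : ℝ) / (n * κ) ≤ s α / A := by
      rw [div_le_div_iff₀ (by positivity) hA0]; linarith [hA2 s]
    have h3 : m * ((1 : ℝ) / (n * κ)) ≤ s x := by
      rw [hsx]; exact mul_le_mul_of_nonneg_left h2 hm0.le
    have h4 : Ω < m / (2 * (n * κ)) := by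
      rw [lt_div_iff₀ (by positivity)]
      have : (0 : ℝ) ≤ P * Fintype.card ι := by positivity
      linarith
    have h5 : m * ((1 : ℝ) / (n * κ)) = m / (2 * (n * κ)) + m / (2 * (n * κ)) := by
      field_simp; norm_num
    linarith
  have hsg_up : ∀ s : K →+* ℝ, s g₀ ≤ m + Ω := fun s => by
    have h1 := (abs_le.mp (hsg s)).1
    have h2 : s α / A ≤ 1 := by rw [div_le_one hA0]; exact hA1 s
    have h3 : s x ≤ m := by
      rw [hsx]; nlinarith
    linarith
  have hsg_pos : ∀ s : K →+* ℝ, 0 < s g₀ := fun s => lt_trans (by positivity) (hsg_low s)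
  set G := {g : 𝓞 K | (∀ s : K →+* ℝ, 0 < s g) ∧ ∀ s : K →+* ℝ, |s g| ≤ B} with hG
  have hmem₀ : g₀ ∈ G := ⟨hsg_pos, fun s => by
    rw [abs_of_pos (hsg_pos s), hB]
    have := hsg_up s
    nlinarith⟩
  have hmem : ∀ k, (P : 𝓞 K) * g₀ + (m : 𝓞 K) * RingOfIntegers.basis K k ∈ G := fun k => by
    have hval : ∀ s : K →+* ℝ, s (((P : 𝓞 K) * g₀ + (m : 𝓞 K) * RingOfIntegers.basis K k : 𝓞 K) : K)
        = P * s g₀ + m * s (integralBasis K k) := fun s => by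
      simp [integralBasis_apply]
    have hpos : ∀ s : K →+* ℝ, 0 < P * s g₀ + m * s (integralBasis K k) := fun s => by
      have h1 := (abs_le.mp (hω k s)).1
      have h2 : (P : ℝ) * (m / (2 * (n * κ))) < P * s g₀ :=
        mul_lt_mul_of_pos_left (hsg_low s) hP0
      have h3 : m * Ω < (P : ℝ) * (m / (2 * (n * κ))) := by
        rw [mul_div_assoc', lt_div_iff₀ (by positivity)]
        nlinarith
      nlinarith
    refine ⟨fun s => by rw [hval]; exact hpos s, fun s => ?_⟩
    rw [hval, abs_of_pos (hpos s), hB]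
    have h1 := (abs_le.mp (hω k s)).2
    have h2 := hsg_up s
    nlinarith
  have hsumfr : (∑ k, fr k : ℚ) ≤ Fintype.card ι := by
    refine (Finset.sum_le_card_nsmul _ _ 1 fun k _ => hfr1 k).trans ?_
    simp [ι]
  have hmq : (0 : ℚ) < m := by exact_mod_cast hm0
  have hcoef : 0 ≤ 1 - P / m * ∑ k, fr k := by
    have h1 : (P : ℚ) * Fintype.card ι ≤ m := by
      have : (P : ℝ) * Fintype.card ι ≤ m := by
        have : 0 ≤ 2 * (n * κ) * Ω := by positivity
        linarith
      exact_mod_cast this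
    have h2 : (P : ℚ) / m * ∑ k, fr k ≤ 1 := by
      rw [div_mul_eq_mul_div, div_le_one hmq]
      exact (mul_le_mul_of_nonneg_left hsumfr (Nat.cast_nonneg _)).trans h1
    linarith
  have hm' : (m : K) ≠ 0 := by
    have : m ≠ 0 := by rintro rfl; simp at hm0
    exact_mod_cast this
  have hAK : (A : K) ≠ 0 := by exact_mod_cast hA0'.ne'
  have hdec : α = ((A / m : ℚ) : K) * (((1 - P / m * ∑ k, fr k : ℚ) : K) * g₀ +
      ∑ k, ((fr k / m : ℚ) : K) *
        (((P : 𝓞 K) * g₀ + (m : 𝓞 K) * RingOfIntegers.basis K k : 𝓞 K) : K)) := by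
    have h1 : ((1 - P / m * ∑ k, fr k : ℚ) : K) * g₀ +
      ∑ k, ((fr k / m : ℚ) : K) *
        (((P : 𝓞 K) * g₀ + (m : 𝓞 K) * RingOfIntegers.basis K k : 𝓞 K) : K) = x := by
      rw [hxg]
      have h2 : ∀ k, ((fr k / m : ℚ) : K) *
        (((P : 𝓞 K) * g₀ + (m : 𝓞 K) * RingOfIntegers.basis K k : 𝓞 K) : K) =
          P / m * g₀ * fr k + fr k * integralBasis K k := fun k => by
        rw [integralBasis_apply]
        push_cast
        field_simp
      rw [Finset.sum_congr rfl fun k _ => h2 k, Finset.sum_add_distrib, ← Finset.mul_sum]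
      push_cast
      ring
    rw [h1, hx]
    push_cast
    field_simp
  rw [hdec]
  have hsub : ∀ g ∈ G, (g : K) ∈ Submodule.span ℚ≥0 ((fun g : 𝓞 K => (g : K)) '' G) :=
    fun g hg => Submodule.subset_span ⟨g, hg, rfl⟩
  refine mul_mem_span_nnrat (by positivity) (add_mem (mul_mem_span_nnrat hcoef (hsub _ hmem₀))
    (sum_mem fun k _ => mul_mem_span_nnrat (div_nonneg (hfr0 k) hmq.le) (hsub _ (hmem k))))

end TotallyReal

namespace OKLattice

variable {K : Type} [Field K]

lemma form_smul_left (L : OKLattice K) (r : 𝓞 K) (x y : L.carrier) :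
    L.form (r • x) y = r * L.form x y := by simp

lemma form_smul_right (L : OKLattice K) (r : 𝓞 K) (x y : L.carrier) :
    L.form x (r • y) = r * L.form x y := by simp

lemma form_nonneg (L : OKLattice K) (x : L.carrier) (s : K →+* ℝ) :
    0 ≤ s (L.form x x) := by
  by_cases hx : x = 0
  · simp [hx]
  · exact (L.posDef x hx s).le

lemma cauchy_schwarz (L : OKLattice K) (x y : L.carrier) (s : K →+* ℝ) :
    s (L.form x y) ^ 2 ≤ s (L.form x x) * s (L.form y y) := by
  by_cases hy : y = 0
  · simp [hy]
  have h := L.form_nonneg (L.form y y • x - L.form x y • y) s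
  have hp := L.posDef y hy s
  have h2 : s (L.form (L.form y y • x - L.form x y • y) (L.form y y • x - L.form x y • y)) =
      s (L.form y y) * (s (L.form x x) * s (L.form y y) - s (L.form x y) ^ 2) := by
    simp [L.symm y x]
    ring
  rw [h2] at h
  linarith [(mul_nonneg_iff_of_pos_left hp).mp h]

lemma form_eq_of_represents (L L' : OKLattice K) [CharZero K] (σ : L'.carrier →ₗ[𝓞 K] L.carrier)
    (h : ∀ x, L.form (σ x) (σ x) = L'.form x x) (x y : L'.carrier) :
    L.form (σ x) (σ y) = L'.form x y := by
  have h1 := h (x + y)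
  simp only [map_add, LinearMap.add_apply, h, L.symm (σ y) (σ x), L'.symm y x] at h1
  have h2 : (2 : 𝓞 K) * L.form (σ x) (σ y) = 2 * L'.form x y := by linear_combination h1
  exact mul_left_cancel₀ two_ne_zero h2

lemma rank_eq_finrank [NumberField K] (L : OKLattice K) :
    L.rank = Module.finrank (𝓞 K) L.carrier :=
  (IsLocalization.finrank_eq K (nonZeroDivisors (𝓞 K)) le_rfl).trans
    (IsLocalizedModule.finrank_eq (nonZeroDivisors (𝓞 K))
      (TensorProduct.mk (𝓞 K) K L.carrier 1) le_rfl)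

/-- The rank one lattice `⟨β⟩`. -/
def unary (β : 𝓞 K) (hβ : ∀ s : K →+* ℝ, 0 < s β) : OKLattice K where
  carrier := 𝓞 K
  form := β • LinearMap.mul (𝓞 K) (𝓞 K)
  symm x y := by simp [mul_comm]
  posDef v hv s := by
    have : s v ≠ 0 := by simpa using hv
    have := hβ s
    change 0 < s (β * (v * v) : 𝓞 K)
    push_cast
    rw [map_mul, map_mul]
    exact mul_pos this (mul_self_pos.mpr ‹_›)

/-- The orthogonal sum of finitely many lattices. -/
def directSum {ι : Type} [Fintype ι] (M : ι → OKLattice K) : OKLattice K where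
  carrier := ∀ i, (M i).carrier
  finite := by
    have := fun i => (M i).finite
    classical infer_instance
  form := ∑ i, (M i).form.compl₁₂ (LinearMap.proj i) (LinearMap.proj i)
  symm x y := by simp [fun i => (M i).symm (x i) (y i)]
  posDef v hv s := by
    obtain ⟨i, hi⟩ := Function.ne_iff.mp hv
    simp only [LinearMap.coe_sum, Finset.sum_apply, LinearMap.compl₁₂_apply, LinearMap.proj_apply,
      map_sum]
    exact Finset.sum_pos' (fun j _ => (M j).form_nonneg _ s)
      ⟨i, Finset.mem_univ i, (M i).posDef _ hi s⟩

lemma directSum_form {ι : Type} [Fintype ι] (M : ι → OKLattice K) (x y : ∀ i, (M i).carrier) :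
    (directSum M).form x y = ∑ i, (M i).form (x i) (y i) := by
  change (∑ i, (M i).form.compl₁₂ (LinearMap.proj i) (LinearMap.proj i)) x y = _
  simp

lemma directSum_represents {ι : Type} [Fintype ι] (M : ι → OKLattice K) (L : OKLattice K)
    (σ : ∀ i, L.carrier →ₗ[𝓞 K] (M i).carrier)
    (h : ∀ x, ∑ i, (M i).form (σ i x) (σ i x) = L.form x x) : (directSum M).Represents L :=
  ⟨LinearMap.pi σ, fun x => (directSum_form M _ _).trans (h x)⟩

/-- The binary lattice with Gram matrix `!![a, b; b, c]`. -/
def binary (a b c : 𝓞 K) (ha : ∀ s : K →+* ℝ, 0 < s a)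
    (hd : ∀ s : K →+* ℝ, s b ^ 2 < s a * s c) : OKLattice K where
  carrier := Fin 2 → 𝓞 K
  form := Matrix.toLinearMap₂' (𝓞 K) !![a, b; b, c]
  symm x y := by
    simp [Matrix.toLinearMap₂'_apply']
    ring
  posDef v hv s := by
    have h : s a * s (Matrix.toLinearMap₂' (𝓞 K) !![a, b; b, c] v v : 𝓞 K) =
        (s a * s (v 0) + s b * s (v 1)) ^ 2 + (s a * s c - s b ^ 2) * s (v 1) ^ 2 := by
      simp [Matrix.toLinearMap₂'_apply', Matrix.mulVec, dotProduct]
      ring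
    refine (mul_pos_iff_of_pos_left (ha s)).mp ?_
    rw [h]
    have hd' := sub_pos.mpr (hd s)
    by_cases h1 : v 1 = 0
    · have h0 : v 0 ≠ 0 := fun h0 => hv (by ext i; fin_cases i <;> simp [h0, h1])
      have : s (v 0) ≠ 0 := by simpa using h0
      have := (ha s).ne'
      simp [h1]
      positivity
    · have : s (v 1) ≠ 0 := by simpa using h1
      positivity

lemma rank_binary [NumberField K] (a b c : 𝓞 K) (ha : ∀ s : K →+* ℝ, 0 < s a)
    (hd : ∀ s : K →+* ℝ, s b ^ 2 < s a * s c) : (binary a b c ha hd).rank = 2 := by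
  rw [rank_eq_finrank]
  exact Module.finrank_fin_fun (𝓞 K)

lemma binary_form (a b c : 𝓞 K) (ha : ∀ s : K →+* ℝ, 0 < s a)
    (hd : ∀ s : K →+* ℝ, s b ^ 2 < s a * s c) (x y : Fin 2 → 𝓞 K) :
    (binary a b c ha hd).form x y =
      a * x 0 * y 0 + b * (x 0 * y 1 + x 1 * y 0) + c * x 1 * y 1 := by
  change Matrix.toLinearMap₂' (𝓞 K) !![a, b; b, c] x y = _
  simp [Matrix.toLinearMap₂'_apply', Matrix.mulVec, dotProduct]
  ring

end OKLattice

namespace TotallyReal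

variable {K : Type} [Field K]

lemma exists_subfield_functional (F : Subfield K) {ω : K} (hω : ω ∉ F) :
    ∃ π : K →ₗ[F] K, π 1 = 0 ∧ π ω ≠ 0 := by
  have hmem : ω ∉ Submodule.span F {(1 : K)} := fun h => by
    obtain ⟨c, rfl⟩ := Submodule.mem_span_singleton.mp h
    exact hω (by simp [Subfield.smul_def])
  obtain ⟨f, hf, hker⟩ := Submodule.exists_le_ker_of_notMem hmem
  refine ⟨(Algebra.linearMap F K).comp f, ?_, by simpa using hf⟩
  have : f 1 = 0 := hker (Submodule.mem_span_singleton_self 1)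
  simp [this]

variable [NumberField K]

lemma linearIndependent_of_gram (L : OKLattice K) (F : Subfield K) {A : ℕ} (v w : Fin A → L.carrier)
    {ω : 𝓞 K} (hω : (ω : K) ∉ F) (hvv : ∀ j k, (L.form (v j) (v k) : K) ∈ F)
    (hvw : ∀ k a, k < a → (L.form (v k) (w a) : K) ∈ F) (hd : ∀ a, L.form (v a) (w a) = ω)
    (s : K →+* ℝ) : LinearIndependent (𝓞 K) v := by
  classical
  obtain ⟨π, hπ1, hπω⟩ := exists_subfield_functional F hω
  have hπF : ∀ x y : K, y ∈ F → π (x * y) = π x * y := fun x y hy => by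
    have := π.map_smul (⟨y, hy⟩ : F) x
    simpa [Subfield.smul_def, mul_comm] using this
  rw [Fintype.linearIndependent_iff]
  intro g hg
  by_contra! hne
  obtain ⟨a, ha, hmax⟩ := Finset.exists_maximal (s := Finset.univ.filter fun i => g i ≠ 0)
    (by simpa [Finset.Nonempty] using hne)
  replace ha : g a ≠ 0 := by simpa using ha
  have ha' : (g a : K) ≠ 0 := by simpa using ha
  have hgt : ∀ k, a < k → g k = 0 := fun k hk => by
    by_contra h
    exact absurd (hmax (by simpa using h) hk.le) (not_le.mpr hk)
  have hrel : ∀ z, ∑ k, (g k : K) / g a * (L.form (v k) z : K) = 0 := fun z => by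
    have h := congrArg (fun x => (L.form x z : K)) hg
    simp only [map_sum, LinearMap.coe_sum, Finset.sum_apply, L.form_smul_left, map_mul, map_zero,
      LinearMap.zero_apply] at h
    simp_rw [div_mul_eq_mul_div, ← Finset.sum_div]
    rw [h, zero_div]
  obtain ⟨b, hb⟩ := IsLocalization.exist_integer_multiples_of_finite (nonZeroDivisors (𝓞 K))
    (fun k => π ((g k : K) / g a))
  choose q hq using hb
  have hb0 : ((b : 𝓞 K) : K) ≠ 0 := by
    simp
  have hq' : ∀ k, (q k : K) = ((b : 𝓞 K) : K) * π ((g k : K) / g a) := fun k => by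
    exact (hq k).trans (Algebra.smul_def _ _)
  set y := ∑ k, q k • v k with hy
  have hyz : ∀ z, (L.form y z : K) = ((b : 𝓞 K) : K) * ∑ k, π ((g k : K) / g a) * (L.form (v k) z : K) :=
    fun z => by
      simp only [hy, map_sum, LinearMap.coe_sum, Finset.sum_apply, L.form_smul_left, map_mul, hq',
        Finset.mul_sum, mul_assoc]
  have hyv : ∀ j, L.form y (v j) = 0 := fun j => by
    have h : (L.form y (v j) : K) = 0 := by
      rw [hyz, Finset.sum_congr rfl fun k _ => (hπF _ _ (hvv k j)).symm, ← map_sum, hrel,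
        map_zero, mul_zero]
    exact_mod_cast h
  have hyy : L.form y y = 0 := by
    conv_lhs => enter [2]; rw [hy]
    simp [hyv]
  have hy0 : y = 0 := by
    by_contra h
    exact (L.posDef y h s).ne' (by simp [hyy])
  have h1 := hyz (w a)
  have h2 := congrArg π (hrel (w a))
  rw [map_sum, map_zero, Fintype.sum_eq_add_sum_compl a, div_self ha', one_mul, hd] at h2
  rw [Fintype.sum_eq_add_sum_compl a, div_self ha', hπ1, zero_mul,
    zero_add, hy0] at h1
  have h3 : ∀ k ∈ ({a} : Finset (Fin A))ᶜ, π ((g k : K) / g a * (L.form (v k) (w a) : K)) =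
      π ((g k : K) / g a) * (L.form (v k) (w a) : K) := fun k hk => by
    rcases lt_or_gt_of_ne (show k ≠ a by simpa using hk) with h | h
    · exact hπF _ _ (hvw k a h)
    · simp [hgt k h]
  rw [Finset.sum_congr rfl h3] at h2
  have h4 : ∑ k ∈ ({a} : Finset (Fin A))ᶜ, π ((g k : K) / g a) * (L.form (v k) (w a) : K) = 0 := by
    simpa [hb0] using h1.symm
  rw [h4, add_zero] at h2
  exact hπω h2

lemma le_rank_of_isUniversal (hK : TotallyReal K) (F : Subfield K) {ω : 𝓞 K} (hω : (ω : K) ∉ F)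
    {M : ℝ} {A : ℕ} (hM : A < M) (hsmall : ∀ x : 𝓞 K, (∀ s : K →+* ℝ, |s x| < M) → (x : K) ∈ F)
    (hωM : ∀ s : K →+* ℝ, |s ω| ≤ M) (L : OKLattice K) (hL : L.IsUniversal 2) : A ≤ L.rank := by
  have hM0 : 0 < M := lt_of_le_of_lt (Nat.cast_nonneg _) hM
  have hsmall' : ∀ x : 𝓞 K, (∀ s : K →+* ℝ, s x ^ 2 < M ^ 2) → (x : K) ∈ F := fun x hx =>
    hsmall x fun s => abs_lt_of_sq_lt_sq (hx s) hM0.le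
  have key : ∀ a : Fin A, ∃ v w : L.carrier, L.form v v = ((a + 1 : ℕ) : 𝓞 K) ∧
      L.form v w = ω ∧ L.form w w = ((⌊M ^ 2 / (a + 1 : ℕ)⌋₊ + 1 : ℕ) : 𝓞 K) := fun a => by
    have ha : (0 : ℝ) < (a + 1 : ℕ) := by positivity
    have hd : ∀ s : K →+* ℝ, s (ω : K) ^ 2 < s (((a + 1 : ℕ) : 𝓞 K) : K) *
        s (((⌊M ^ 2 / (a + 1 : ℕ)⌋₊ + 1 : ℕ) : 𝓞 K) : K) := fun s => by
      have h1 : s ω ^ 2 ≤ M ^ 2 := sq_le_sq' (by linarith [(abs_le.mp (hωM s)).1])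
        ((abs_le.mp (hωM s)).2)
      have h2 := Nat.lt_floor_add_one (M ^ 2 / (a + 1 : ℕ))
      rw [div_lt_iff₀ ha] at h2
      simp only [map_natCast]
      refine h1.trans_lt (h2.trans_eq ?_)
      push_cast
      ring
    obtain ⟨σ, hσ⟩ := hL (OKLattice.binary _ ω _ (fun s => by simpa using ha) hd)
      (OKLattice.rank_binary _ _ _ _ _)
    have hσ' := L.form_eq_of_represents _ σ hσ
    refine ⟨σ (Pi.single 0 1 : Fin 2 → 𝓞 K), σ (Pi.single 1 1 : Fin 2 → 𝓞 K), ?_, ?_, ?_⟩ <;>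
    · refine (hσ' _ _).trans ((OKLattice.binary_form _ _ _ _ _ _ _).trans ?_)
      simp
  choose v w hvv hvw hww using key
  have hlt : ∀ j : Fin A, ((j + 1 : ℕ) : ℝ) ≤ A := fun j => by exact_mod_cast j.2
  have hcast : ∀ (s : K →+* ℝ) (n : ℕ), s (((n : ℕ) : 𝓞 K) : K) = n := fun s n => by simp
  have hli : LinearIndependent (𝓞 K) v := by
    refine linearIndependent_of_gram L F v w hω (fun j k => hsmall' _ fun s => ?_)
      (fun k a hka => hsmall' _ fun s => ?_) hvw hK.nonempty_embedding.some
    · refine (L.cauchy_schwarz _ _ s).trans_lt ?_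
      rw [hvv, hvv, hcast, hcast, sq]
      have := hlt j
      have := hlt k
      have : (0 : ℝ) ≤ (j + 1 : ℕ) := by positivity
      have : (0 : ℝ) ≤ (k + 1 : ℕ) := by positivity
      nlinarith
    · refine (L.cauchy_schwarz _ _ s).trans_lt ?_
      rw [hvv, hww, hcast, hcast]
      have ha := hlt a
      have ha0 : (0 : ℝ) < (a + 1 : ℕ) := by positivity
      have hk : ((k + 1 : ℕ) : ℝ) ≤ (a + 1 : ℕ) - 1 := by
        have : (k : ℕ) + 1 ≤ a := hka
        push_cast
        rw [add_sub_cancel_right]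
        exact_mod_cast this
      have h2 : ((⌊M ^ 2 / (a + 1 : ℕ)⌋₊ + 1 : ℕ) : ℝ) ≤ M ^ 2 / (a + 1 : ℕ) + 1 := by
        push_cast
        have := Nat.floor_le (a := M ^ 2 / (a + 1 : ℕ)) (by positivity)
        push_cast at this
        linarith
      have h3 : M ^ 2 / (a + 1 : ℕ) * (a + 1 : ℕ) = M ^ 2 := div_mul_cancel₀ _ ha0.ne'
      set x : ℝ := ((a + 1 : ℕ) : ℝ)
      have h4 : x < M ^ 2 / x := by
        rw [lt_div_iff₀ ha0]; nlinarith
      have hx1 : 1 ≤ x := by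
        have : (0 : ℝ) ≤ (k + 1 : ℕ) := by positivity
        linarith
      calc ((k + 1 : ℕ) : ℝ) * ((⌊M ^ 2 / x⌋₊ + 1 : ℕ) : ℝ)
          ≤ (x - 1) * (M ^ 2 / x + 1) := mul_le_mul hk h2 (by positivity) (by linarith)
        _ < M ^ 2 := by nlinarith
  have := hli.fintype_card_le_finrank
  rwa [Fintype.card_fin, ← L.rank_eq_finrank] at this

end TotallyReal

namespace TotallyReal

lemma exists_generator_outside {K : Type} [Field K] [NumberField K] (hK : TotallyReal K) {A : ℝ}
    {F : Subfield K} (hF : F ≠ ⊤)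
    (hA : ∀ x : 𝓞 K, (∀ s : K →+* ℝ, |s x| ≤ A) → (x : K) ∈ F) :
    ∃ (ω : 𝓞 K) (M : ℝ), (ω : K) ∉ F ∧ A < M ∧
      (∀ x : 𝓞 K, (∀ s : K →+* ℝ, |s x| < M) → (x : K) ∈ F) ∧ ∀ s : K →+* ℝ, |s ω| ≤ M := by
  obtain ⟨ω₀, hω₀⟩ : ∃ ω : 𝓞 K, (ω : K) ∉ F := by
    by_contra! h
    refine hF (eq_top_iff.mpr fun x _ => ?_)
    obtain ⟨a, b, -, rfl⟩ := IsFractionRing.div_surjective (A := 𝓞 K) x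
    exact F.div_mem (h a) (h b)
  have hne := hK.nonempty_embedding
  let house : 𝓞 K → ℝ := fun x => ‖fun s : K →+* ℝ => s x‖
  have hle : ∀ (x : 𝓞 K) (s : K →+* ℝ), |s x| ≤ house x := fun x s =>
    norm_le_pi_norm (fun s : K →+* ℝ => s x) s
  obtain ⟨ω, ⟨hω, hω₁⟩, hmin⟩ := Set.exists_min_image
    {x : 𝓞 K | (x : K) ∉ F ∧ house x ≤ house ω₀} house
    ((hK.finite_bounded_integers (house ω₀)).subset fun x hx s => (hle x s).trans hx.2)
    ⟨ω₀, hω₀, le_rfl⟩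
  refine ⟨ω, house ω, hω, ?_, fun x hx => ?_, hle ω⟩
  · by_contra! h
    exact hω (hA ω fun s => (hle ω s).trans h)
  · by_contra hxF
    have h1 : house x < house ω := by
      refine (pi_norm_lt_iff ?_).mpr hx
      obtain ⟨s⟩ := hne
      exact (abs_nonneg _).trans_lt (hx s)
    exact absurd (hmin x ⟨hxF, h1.le.trans hω₁⟩) (not_le.mpr h1)

lemma exists_finite_superset (d : ℕ) (B : ℝ) :
    ∃ S : Set ℝ, S.Finite ∧ ∀ K : Subfield ℝ, FiniteDimensional ℚ K → TotallyReal K →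
      Module.finrank ℚ K = d → ∀ x : 𝓞 K, (∀ s : K →+* ℝ, |s x| ≤ B) → ((x : K) : ℝ) ∈ S := by
  classical
  let C := Nat.ceil (max B 1 ^ d * d.choose (d / 2))
  refine ⟨_, Polynomial.bUnion_roots_finite (algebraMap ℤ ℝ) d (Set.finite_Icc (-C : ℤ) C),
    fun K hfin hK hd x hx => ?_⟩
  have : NumberField K := ⟨⟩
  simp_rw [Set.mem_iUnion]
  have hint : IsIntegral ℤ (x : K) := x.isIntegral_coe
  have hx' : ∀ φ : K →+* ℂ, ‖φ x‖ ≤ B := fun φ => by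
    obtain ⟨s, rfl⟩ := hK.exists_real_embedding φ
    simpa using hx s
  have hmin := minpoly.isIntegrallyClosed_eq_field_fractions' ℚ hint
  refine ⟨minpoly ℤ (x : K), ⟨?_, fun i => ?_⟩, ?_⟩
  · rw [← (minpoly.monic hint).natDegree_map (algebraMap ℤ ℚ), ← hmin, ← hd]
    exact minpoly.natDegree_le _
  · rw [Set.mem_Icc, ← abs_le, ← @Int.cast_le ℝ]
    have h := NumberField.Embeddings.coeff_bdd_of_norm_le hx' i
    rw [hd] at h
    refine (Eq.trans_le ?_ h).trans (Nat.le_ceil _)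
    rw [hmin, Polynomial.coeff_map, eq_intCast, Int.norm_cast_rat, Int.norm_eq_abs, Int.cast_abs]
  · refine Polynomial.mem_rootSet.2 ⟨minpoly.ne_zero hint, ?_⟩
    have h := congrArg (algebraMap K ℝ) (minpoly.aeval ℤ (x : K))
    rw [map_zero, ← Polynomial.aeval_algebraMap_apply] at h
    exact h

lemma finite_of_exists_universal
    (hex : ∀ (K : Type) [Field K] [NumberField K], TotallyReal K →
      ∃ L : OKLattice K, L.IsUniversal 2) (C : ℝ) (d : ℕ) :
    {K : Subfield ℝ |
      FiniteDimensional ℚ K ∧ TotallyReal K ∧ Module.finrank ℚ K = d ∧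
        (minUnivRank K 2 : ℝ) < C}.Finite := by
  obtain ⟨S, hS, hSK⟩ := exists_finite_superset d ⌈C⌉₊
  refine (hS.finite_subsets.image Subfield.closure).subset ?_
  rintro K ⟨hfin, hK, hd, hC⟩
  have : NumberField K := ⟨⟩
  set G : Set K := {x | ∃ o : 𝓞 K, (o : K) = x ∧ ∀ s : K →+* ℝ, |s o| ≤ ⌈C⌉₊} with hG
  by_cases hF : Subfield.closure G = ⊤
  · refine ⟨K.subtype '' G, ?_, ?_⟩
    · rintro _ ⟨_, ⟨o, rfl, ho⟩, rfl⟩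
      exact hSK K hfin hK hd o ho
    · rw [← RingHom.map_field_closure, hF, ← RingHom.fieldRange_eq_map, Subfield.fieldRange_subtype]
  · exfalso
    obtain ⟨ω, M, hω, hM, hsmall, hωM⟩ := hK.exists_generator_outside hF
      (fun x hx => Subfield.subset_closure ⟨x, rfl, hx⟩)
    obtain ⟨L₀, hL₀⟩ := hex K hK
    obtain ⟨L, hL, hrank⟩ := Nat.sInf_mem (s := {m | ∃ L : OKLattice K, L.IsUniversal 2 ∧ L.rank = m})
      ⟨_, L₀, hL₀, rfl⟩
    have h := hK.le_rank_of_isUniversal _ hω hM hsmall hωM L hL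
    rw [hrank] at h
    have h1 : (⌈C⌉₊ : ℝ) ≤ minUnivRank K 2 := by exact_mod_cast h
    linarith [Nat.le_ceil C]

end TotallyReal

namespace TotallyReal

variable {K : Type} [Field K] [NumberField K]

lemma prod_unit_sq_mul (hK : TotallyReal K) (u : (𝓞 K)ˣ) (a : K) :
    ∏ s : K →+* ℝ, s ((u : K) ^ 2 * a) = ∏ s : K →+* ℝ, s a := by
  have h := NumberField.isUnit_iff_norm.mp u.isUnit
  rw [RingOfIntegers.coe_norm] at h
  have h' : ((Algebra.norm ℚ (u : K) : ℚ) : ℝ) ^ 2 = 1 := by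
    rw [← sq_abs, ← Rat.cast_abs, h]; simp
  rw [hK.norm_eq_prod] at h'
  simp only [map_mul, map_pow, Finset.prod_mul_distrib, Finset.prod_pow, h', one_mul]

lemma exists_min_balanced (hK : TotallyReal K) : ∃ κ : ℝ, 1 ≤ κ ∧ ∀ S : Set (𝓞 K), S.Nonempty →
    (∀ a ∈ S, ∀ s : K →+* ℝ, 0 < s a) → (∀ a ∈ S, ∀ u : (𝓞 K)ˣ, (u : 𝓞 K) ^ 2 * a ∈ S) →
    ∀ f : K, (∀ s : K →+* ℝ, 0 < s f) → ∃ a ∈ S, (∀ s t : K →+* ℝ, s (f * a) ≤ κ * t (f * a)) ∧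
      ∀ b ∈ S, ∃ s : K →+* ℝ, s a ≤ s b := by
  obtain ⟨κ, hκ, hbal⟩ := hK.exists_unit_sq_balanced
  refine ⟨κ, hκ, fun S hne hpos hu f hf => ?_⟩
  have hne' := hK.nonempty_embedding
  obtain ⟨a, ha, hmin⟩ := (measure fun x : 𝓞 K => (Algebra.norm ℤ x).natAbs).wf.has_min S hne
  have hnat : ∀ b ∈ S, ((Algebra.norm ℤ b).natAbs : ℝ) = ∏ s : K →+* ℝ, s b := fun b hb => by
    rw [← hK.norm_eq_prod, Nat.cast_natAbs, ← Algebra.coe_norm_int, Rat.cast_intCast, Int.cast_abs,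
      abs_of_nonneg]
    have h : ((Algebra.norm ℤ b : ℤ) : ℝ) = ∏ s : K →+* ℝ, s b := by
      rw [← hK.norm_eq_prod, ← Algebra.coe_norm_int, Rat.cast_intCast]
    rw [h]
    exact Finset.prod_nonneg fun s _ => (hpos b hb s).le
  obtain ⟨u, hκu⟩ := hbal (f * a) fun s => by
    rw [map_mul]; exact mul_pos (hf s) (hpos a ha s)
  refine ⟨(u : 𝓞 K) ^ 2 * a, hu a ha u, fun s t => ?_, fun b hb => ?_⟩
  · have := hκu s t
    push_cast
    rwa [mul_left_comm]
  · by_contra! h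
    refine hmin b hb ?_
    change (Algebra.norm ℤ b).natAbs < (Algebra.norm ℤ a).natAbs
    rw [← @Nat.cast_lt ℝ, hnat b hb, hnat a ha, ← hK.prod_unit_sq_mul u (a : K)]
    have h' : ∀ s : K →+* ℝ, s b < s ((u : K) ^ 2 * a) := fun s => by simpa using h s
    exact Finset.prod_lt_prod_of_nonempty (fun s _ => hpos b hb s) (fun s _ => h' s)
      Finset.univ_nonempty

end TotallyReal

namespace OKLattice

variable {K : Type} [Field K]

lemma eq_zero_of_form_self (hs : Nonempty (K →+* ℝ)) (L : OKLattice K) {x : L.carrier}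
    (h : L.form x x = 0) : x = 0 := by
  by_contra hx
  obtain ⟨s⟩ := hs
  exact (L.posDef x hx s).ne' (by simp [h])

/-- The Gram determinant of two vectors. -/
def gram (L : OKLattice K) (v w : L.carrier) : 𝓞 K :=
  L.form v v * L.form w w - L.form v w ^ 2

lemma gram_nonneg (L : OKLattice K) (v w : L.carrier) (s : K →+* ℝ) : 0 ≤ s (L.gram v w) := by
  have := L.cauchy_schwarz v w s
  simp only [gram, map_sub, map_mul, map_pow]
  linarith

lemma gram_pos (L : OKLattice K) {v w : L.carrier} (h : L.gram v w ≠ 0) (s : K →+* ℝ) :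
    0 < s (L.gram v w) :=
  (L.gram_nonneg v w s).lt_of_ne' (by simpa using h)

lemma gram_smul (L : OKLattice K) (v w : L.carrier) (r : 𝓞 K) :
    L.gram v (r • w) = r ^ 2 * L.gram v w := by
  simp only [gram, form_smul_left, form_smul_right]
  ring

lemma eq_of_gram_eq_zero (hs : Nonempty (K →+* ℝ)) (L : OKLattice K) {v w : L.carrier}
    (h : L.gram v w = 0) : L.form v v • w = L.form v w • v := by
  rw [← sub_eq_zero]
  refine L.eq_zero_of_form_self hs ?_
  rw [gram] at h
  simp only [map_sub, LinearMap.sub_apply, form_smul_left, form_smul_right, L.symm w v]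
  linear_combination L.form v v * h

variable [NumberField K]

lemma exists_gram_ne_zero (hs : Nonempty (K →+* ℝ)) (L : OKLattice K) (hL : L.rank = 2)
    {v : L.carrier} (hv : v ≠ 0) : ∃ w, L.gram v w ≠ 0 := by
  obtain ⟨w, hw⟩ := exists_linearIndependent_pair_of_one_lt_finrank (R := 𝓞 K)
    (by rw [← L.rank_eq_finrank, hL]; norm_num) hv
  refine ⟨w, fun h => hv (L.eq_zero_of_form_self hs ?_)⟩
  refine (LinearIndependent.pair_iff.mp hw (-L.form v w) (L.form v v) ?_).2
  rw [L.eq_of_gram_eq_zero hs h, neg_smul, neg_add_cancel]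

lemma exists_ne_zero (L : OKLattice K) (hL : L.rank = 2) : ∃ v : L.carrier, v ≠ 0 := by
  by_contra! h
  have : Subsingleton L.carrier := ⟨fun x y => by rw [h x, h y]⟩
  have h1 := Module.finrank_zero_of_subsingleton (R := 𝓞 K) (M := L.carrier)
  rw [← L.rank_eq_finrank, hL] at h1
  omega

lemma gram_expansion (hs : Nonempty (K →+* ℝ)) (L : OKLattice K) (hL : L.rank = 2)
    {v w : L.carrier} (h : L.gram v w ≠ 0) (x : L.carrier) :
    L.gram v w • x = (L.form w w * L.form v x - L.form v w * L.form w x) • v +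
      (L.form v v * L.form w x - L.form v w * L.form v x) • w := by
  rw [← sub_eq_zero]
  set z := L.gram v w • x - _ with hz
  have hzv : L.form z v = 0 := by
    simp only [hz, gram, map_sub, map_add, LinearMap.sub_apply, LinearMap.add_apply,
      form_smul_left, L.symm w v, L.symm x v]
    ring
  have hzw : L.form z w = 0 := by
    simp only [hz, gram, map_sub, map_add, LinearMap.sub_apply, LinearMap.add_apply,
      form_smul_left, L.symm x w]
    ring
  by_contra hz0
  have hzz : L.form z z ≠ 0 := fun h => hz0 (L.eq_zero_of_form_self hs h)
  have hli : LinearIndependent (𝓞 K) ![v, w, z] := by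
    rw [Fintype.linearIndependent_iff]
    intro g hg
    have hgx : ∀ y, g 0 * L.form v y + g 1 * L.form w y + g 2 * L.form z y = 0 := fun y => by
      have := congrArg (fun u => L.form u y) hg
      simpa [Fin.sum_univ_three] using this
    have h2 : g 2 = 0 := by
      have := hgx z
      rw [L.symm v, L.symm w, hzv, hzw] at this
      simpa [hzz] using this
    have h3 := hgx v
    have h4 := hgx w
    rw [h2, zero_mul, add_zero, L.symm w v] at h3
    rw [h2, zero_mul, add_zero] at h4
    rw [gram] at h
    have h0 : g 0 = 0 := by
      refine (mul_eq_zero.mp ?_).resolve_right h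
      linear_combination L.form w w * h3 - L.form v w * h4
    have h1 : g 1 = 0 := by
      refine (mul_eq_zero.mp ?_).resolve_right h
      linear_combination L.form v v * h4 - L.form v w * h3
    intro i
    fin_cases i
    exacts [h0, h1, h2]
  have := hli.fintype_card_le_finrank
  rw [← L.rank_eq_finrank, hL] at this
  simp at this

end OKLattice

lemma exists_linear_quotient {R M : Type*} [CommRing R] [IsDomain R] [AddCommGroup M] [Module R M]
    (f : M →ₗ[R] R) {D : R} (hD : D ≠ 0) (h : ∀ x, D ∣ f x) :
    ∃ g : M →ₗ[R] R, ∀ x, f x = D * g x := by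
  choose g hg using h
  refine ⟨{ toFun := g, map_add' := fun x y => ?_, map_smul' := fun r x => ?_ }, hg⟩
  · refine mul_left_cancel₀ hD ?_
    rw [mul_add, ← hg, ← hg, ← hg, map_add]
  · refine mul_left_cancel₀ hD ?_
    rw [← hg, map_smul, smul_eq_mul, smul_eq_mul, hg x, RingHom.id_apply]
    ring

namespace OKLattice

variable {K : Type} [Field K]

lemma gram_add_smul (L : OKLattice K) (v w : L.carrier) (p q : 𝓞 K) :
    L.gram v (p • v + q • w) = q ^ 2 * L.gram v w := by
  simp only [gram, map_add, LinearMap.add_apply, form_smul_left, form_smul_right, L.symm w v]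
  ring

end OKLattice

namespace TotallyReal

variable {K : Type} [Field K]

lemma exists_dvd_of_near {η : ℝ} {T : ℕ} (n D : 𝓞 K) (hD : D ≠ 0)
    (hT : ∃ r : ℕ, 1 ≤ r ∧ r ≤ T ∧ ∃ o : 𝓞 K, ∀ s : K →+* ℝ, |s (r * ((n : K) / D) - o)| ≤ η) :
    ∃ r : ℕ, 1 ≤ r ∧ r ≤ T ∧ ∃ o : 𝓞 K,
      ∀ s : K →+* ℝ, |s ((r * n - o * D : 𝓞 K) : K)| ≤ η * |s D| := by
  obtain ⟨r, hr1, hrT, o, ho⟩ := hT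
  refine ⟨r, hr1, hrT, o, fun s => ?_⟩
  have hD' : (D : K) ≠ 0 := by simpa using hD
  have h : ((r * n - o * D : 𝓞 K) : K) = (r * ((n : K) / D) - o) * D := by
    push_cast
    field_simp
  rw [h, map_mul, abs_mul]
  exact mul_le_mul_of_nonneg_right (ho s) (abs_nonneg _)

variable [NumberField K]

lemma exists_reduced_basis (hK : TotallyReal K) : ∃ κ c₁ : ℝ, 1 ≤ κ ∧ 1 ≤ c₁ ∧ ∃ H : ℕ, H ≠ 0 ∧
    ∀ L : OKLattice K, L.rank = 2 → ∃ (v w : L.carrier) (X Y : L.carrier →ₗ[𝓞 K] 𝓞 K),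
      v ≠ 0 ∧ L.gram v w ≠ 0 ∧ (∀ x, (H : 𝓞 K) • x = X x • v + Y x • w) ∧
      (∀ s t : K →+* ℝ, s (L.form v v) ≤ κ * t (L.form v v)) ∧
      (∀ s t : K →+* ℝ, s ((L.gram v w : K) / L.form v v) ≤ κ * t ((L.gram v w : K) / L.form v v)) ∧
      ∀ s t : K →+* ℝ, s (L.form v v) ≤ c₁ * t ((L.gram v w : K) / L.form v v) := by
  obtain ⟨κ, hκ, hmin⟩ := hK.exists_min_balanced
  obtain ⟨T, hT1, hT⟩ := exists_multiple_near_integer (K := K) (η := 1 / 2) (by norm_num)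
  have hT1' : (1 : ℝ) ≤ T := by exact_mod_cast hT1
  have hne := hK.nonempty_embedding
  refine ⟨κ, 2 * T ^ 2 * κ ^ 2, hκ, ?_, T.factorial ^ 2, by positivity, fun L hL => ?_⟩
  · nlinarith [one_le_pow₀ hκ (n := 2), one_le_pow₀ hT1' (n := 2)]
  obtain ⟨_, ⟨v, hv, rfl⟩, hbv, hminv⟩ := hmin {a | ∃ v : L.carrier, v ≠ 0 ∧ L.form v v = a}
    ((L.exists_ne_zero hL).elim fun v hv => ⟨_, v, hv, rfl⟩)
    (by rintro _ ⟨v, hv, rfl⟩ s; exact L.posDef v hv s)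
    (by
      rintro _ ⟨v, hv, rfl⟩ u
      refine ⟨(u : 𝓞 K) • v, smul_ne_zero u.ne_zero hv, ?_⟩
      rw [L.form_smul_left, L.form_smul_right]
      ring) 1 (by simp)
  simp only [one_mul] at hbv
  have hvpos := L.posDef v hv
  obtain ⟨_, ⟨w, hw, rfl⟩, hbw, hminw⟩ := hmin {a | ∃ w, L.gram v w ≠ 0 ∧ L.gram v w = a}
    ((L.exists_gram_ne_zero hne hL hv).elim fun w hw => ⟨_, w, hw, rfl⟩)
    (by rintro _ ⟨w, hw, rfl⟩ s; exact L.gram_pos hw s)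
    (by
      rintro _ ⟨w, hw, rfl⟩ u
      refine ⟨(u : 𝓞 K) • w, ?_, L.gram_smul v w u⟩
      rw [L.gram_smul]
      exact mul_ne_zero (pow_ne_zero _ u.ne_zero) hw) (L.form v v : K)⁻¹
    (fun s => by rw [map_inv₀]; exact inv_pos.mpr (hvpos s))
  simp only [inv_mul_eq_div] at hbw
  set D := L.gram v w with hD
  have hDpos : ∀ s : K →+* ℝ, 0 < s D := L.gram_pos hw
  have hexp := L.gram_expansion hne hL hw
  set N₁ : L.carrier →ₗ[𝓞 K] 𝓞 K := L.form w w • L.form v - L.form v w • L.form w with hN₁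
  set N₂ : L.carrier →ₗ[𝓞 K] 𝓞 K := L.form v v • L.form w - L.form v w • L.form v with hN₂
  replace hexp : ∀ x, D • x = N₁ x • v + N₂ x • w := hexp
  have hN₁w : N₁ w = 0 := by simp [hN₁, mul_comm]
  have hN₂w : N₂ w = D := by simp [hN₂, hD, OKLattice.gram, sq]
  have hdvd₂ : ∀ x, D ∣ T.factorial * N₂ x := fun x => by
    obtain ⟨r, hr1, hrT, o, ho⟩ := exists_dvd_of_near (N₂ x) D hw (hT _)
    set q := (r : 𝓞 K) * N₂ x - o * D with hq
    have h1 : D • ((r : 𝓞 K) • x - o • w) = ((r : 𝓞 K) * N₁ x) • v + q • w := by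
      rw [smul_sub, smul_comm D, hexp x, smul_comm D, smul_add, smul_smul, smul_smul, hq, sub_smul,
        mul_smul o D w, add_sub_assoc]
    have h2 := congrArg (L.gram v) h1
    rw [L.gram_smul, L.gram_add_smul, ← hD] at h2
    have h3 : D * L.gram v ((r : 𝓞 K) • x - o • w) = q ^ 2 :=
      mul_left_cancel₀ hw (by linear_combination h2)
    have hq0 : q = 0 := by
      by_contra hq0
      have h4 : L.gram v ((r : 𝓞 K) • x - o • w) ≠ 0 := fun h => by
        rw [h, mul_zero] at h3
        exact hq0 (pow_eq_zero_iff two_ne_zero |>.mp h3.symm)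
      obtain ⟨s, hs⟩ := hminw _ ⟨_, h4, rfl⟩
      have h5 := congrArg (fun y : 𝓞 K => s y) h3
      simp only [map_mul, map_pow] at h5
      have h6 := ho s
      have h7 := hDpos s
      rw [abs_of_pos h7] at h6
      have h8 := sq_le_sq.mpr (h6.trans (le_abs_self _))
      nlinarith
    have hr : r ∣ T.factorial := Nat.dvd_factorial hr1 hrT
    have h9 : D ∣ r * N₂ x := ⟨o, by linear_combination hq0⟩
    exact h9.trans (mul_dvd_mul_right (Nat.cast_dvd_cast hr) _)
  have hdvd₁ : ∀ x, D ∣ T.factorial ^ 2 * N₁ x := fun x => by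
    obtain ⟨k, hk⟩ := hdvd₂ x
    set x' := (T.factorial : 𝓞 K) • x - k • w with hx'
    have hN₂x' : N₂ x' = 0 := by
      rw [hx', map_sub, map_smul, map_smul, hN₂w, smul_eq_mul, smul_eq_mul, hk]; ring
    have hN₁x' : N₁ x' = T.factorial * N₁ x := by
      rw [hx', map_sub, map_smul, map_smul, hN₁w, smul_eq_mul, smul_zero, sub_zero]
    obtain ⟨r, hr1, hrT, o, ho⟩ := exists_dvd_of_near (N₁ x') D hw (hT _)
    set q := (r : 𝓞 K) * N₁ x' - o * D with hq
    set y := (r : 𝓞 K) • x' - o • v with hy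
    have h1 : D • y = q • v := by
      rw [hy, smul_sub, smul_comm D, hexp x', hN₂x', zero_smul, add_zero, smul_smul, smul_smul, hq,
        sub_smul, mul_comm D]
    have h3 : D ^ 2 * L.form y y = q ^ 2 * L.form v v := by
      have h2 := congrArg (fun z => L.form z z) h1
      simp only [L.form_smul_left, L.form_smul_right] at h2
      linear_combination h2
    have hq0 : q = 0 := by
      by_contra hq0
      have h4 : y ≠ 0 := fun h => by
        rw [h, smul_zero] at h1
        exact smul_ne_zero hq0 hv h1.symm
      obtain ⟨s, hs⟩ := hminv _ ⟨_, h4, rfl⟩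
      have h5 := congrArg (fun y : 𝓞 K => s y) h3
      simp only [map_mul, map_pow] at h5
      have h6 := ho s
      have h7 := hDpos s
      rw [abs_of_pos h7] at h6
      have h8 := sq_le_sq.mpr (h6.trans (le_abs_self _))
      have h9 := hvpos s
      have h10 : s D ^ 2 * s (L.form v v) ≤ s D ^ 2 * s (L.form y y) :=
        mul_le_mul_of_nonneg_left hs (sq_nonneg _)
      have h11 := mul_le_mul_of_nonneg_right h8 h9.le
      have h12 : 0 < s D ^ 2 * s (L.form v v) := by positivity
      nlinarith
    have hr : r ∣ T.factorial := Nat.dvd_factorial hr1 hrT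
    have h9 : D ∣ r * (T.factorial * N₁ x) := ⟨o, by rw [← hN₁x']; linear_combination hq0⟩
    rw [sq, mul_assoc]
    exact h9.trans (mul_dvd_mul_right (Nat.cast_dvd_cast hr) _)
  obtain ⟨X, hX⟩ := exists_linear_quotient ((T.factorial : 𝓞 K) ^ 2 • N₁) hw hdvd₁
  obtain ⟨Y, hY⟩ := exists_linear_quotient ((T.factorial : 𝓞 K) ^ 2 • N₂) hw fun x => by
    rw [LinearMap.smul_apply, smul_eq_mul, sq, mul_assoc]
    exact (hdvd₂ x).mul_left _
  simp only [LinearMap.smul_apply, smul_eq_mul] at hX hY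
  refine ⟨v, w, X, Y, hv, hw, fun x => ?_, hbv, hbw, fun s t => ?_⟩
  · refine smul_right_injective _ hw ?_
    simp only
    rw [smul_comm, hexp, smul_add, smul_add, smul_smul, smul_smul, smul_smul, smul_smul, ← hX,
      ← hY]
    push_cast
    rfl
  · have hv0 : L.form v v ≠ 0 := fun h => hv (L.eq_zero_of_form_self hne h)
    obtain ⟨r, hr1, hrT, o, ho⟩ := exists_dvd_of_near (L.form v w) (L.form v v) hv0 (hT _)
    set x := (r : 𝓞 K) • w - o • v with hx
    have hx0 : x ≠ 0 := fun h => by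
      have h1 : (-o) • v + (r : 𝓞 K) • w = 0 := by rw [← h, hx, neg_smul]; abel
      have h2 := congrArg (L.gram v) h1
      rw [L.gram_add_smul] at h2
      have h3 : (r : 𝓞 K) ≠ 0 := by exact_mod_cast (by omega : r ≠ 0)
      refine mul_ne_zero (pow_ne_zero 2 h3) hw (h2.trans ?_)
      simp [OKLattice.gram]
    obtain ⟨s', hs'⟩ := hminv _ ⟨x, hx0, rfl⟩
    have h1 : L.form v v * L.form x x =
        (r * L.form v w - o * L.form v v) ^ 2 + r ^ 2 * D := by
      simp only [hx, hD, OKLattice.gram, map_sub, LinearMap.sub_apply, L.form_smul_left,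
        L.form_smul_right, L.symm w v]
      ring
    have h2 := congrArg (fun y : 𝓞 K => s' y) h1
    have h3 := ho s'
    set q := (r : 𝓞 K) * L.form v w - o * L.form v v
    simp only [map_mul, map_pow, map_add, map_natCast] at h2
    have ha := hvpos s'
    rw [abs_of_pos ha] at h3
    have h4 := sq_le_sq.mpr (h3.trans (le_abs_self _))
    have h5 : s' D = s' (L.form v v) * s' ((D : K) / L.form v v) := by
      rw [← map_mul, mul_div_cancel₀]
      simpa using hv0
    set a := s' (L.form v v : K)
    set e := s' ((D : K) / L.form v v) with he
    have he0 : 0 < e := by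
      rw [he, map_div₀]; exact div_pos (hDpos s') ha
    have h6 : a * (3 / 4 * a) ≤ a * (r ^ 2 * e) := by
      rw [h5] at h2
      nlinarith [mul_le_mul_of_nonneg_left hs' ha.le]
    have h7 := le_of_mul_le_mul_left h6 ha
    have h8 : (r : ℝ) ^ 2 ≤ T ^ 2 := by
      have : (r : ℝ) ≤ T := by exact_mod_cast hrT
      gcongr
    have h9 : a ≤ 2 * T ^ 2 * e := by nlinarith
    calc s (L.form v v) ≤ κ * a := hbv s s'
      _ ≤ κ * (2 * T ^ 2 * e) := by gcongr
      _ ≤ κ * (2 * T ^ 2 * (κ * t ((D : K) / L.form v v))) := by gcongr; exact hbw s' t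
      _ = _ := by ring

end TotallyReal

namespace TotallyReal

variable {K : Type} [Field K]

/-- The coefficients `(A, B, C)` of `A X² + 2 B X Y + C Y² = β (p X + q Y)²`, where
`γ = (β, p, q)`. -/
def squareCoeffs (γ : 𝓞 K × 𝓞 K × 𝓞 K) : K × K × K :=
  (γ.1 * γ.2.1 ^ 2, γ.1 * γ.2.1 * γ.2.2, γ.1 * γ.2.2 ^ 2)

variable [NumberField K]

lemma mem_cone_of_dominant {G : Set (𝓞 K)} {Γ : Set (𝓞 K × 𝓞 K × 𝓞 K)}
    (hΓ₁ : ∀ g ∈ G, (g, 1, 0) ∈ Γ) (hΓ₂ : ∀ g ∈ G, (g, 0, 1) ∈ Γ)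
    (hΓ₃ : ∀ k, (1, 1, RingOfIntegers.basis K k) ∈ Γ)
    (hΓ₄ : ∀ k, (1, 1, -RingOfIntegers.basis K k) ∈ Γ) {a μ c : K}
    (ha : a - ∑ k, ((|(integralBasis K).repr μ k| : ℚ) : K) ∈
      Submodule.span ℚ≥0 ((fun g : 𝓞 K => (g : K)) '' G))
    (hc : c - ∑ k, ((|(integralBasis K).repr μ k| : ℚ) : K) * integralBasis K k ^ 2 ∈
      Submodule.span ℚ≥0 ((fun g : 𝓞 K => (g : K)) '' G)) :
    (a, μ, c) ∈ Submodule.span ℚ≥0 (squareCoeffs '' Γ) := by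
  set z : Module.Free.ChooseBasisIndex ℤ (𝓞 K) → ℚ≥0 :=
    fun k => ⟨|(integralBasis K).repr μ k|, abs_nonneg _⟩ with hz
  have hzK : ∀ k, ((|(integralBasis K).repr μ k| : ℚ) : K) = (z k : K) := fun k => by
    rw [← Rat.cast_nnratCast]; rfl
  set S := Submodule.span ℚ≥0 (squareCoeffs '' Γ) with hS
  have h1 : ∀ x ∈ Submodule.span ℚ≥0 ((fun g : 𝓞 K => (g : K)) '' G), (x, 0, 0) ∈ S := by
    intro x hx
    refine (Submodule.span_le (p := S.comap (LinearMap.inl ℚ≥0 K (K × K)))).mpr ?_ hx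
    rintro _ ⟨g, hg, rfl⟩
    refine Submodule.subset_span ⟨_, hΓ₁ g hg, ?_⟩
    simp [squareCoeffs]
  have h2 : ∀ x ∈ Submodule.span ℚ≥0 ((fun g : 𝓞 K => (g : K)) '' G), (0, 0, x) ∈ S := by
    intro x hx
    refine (Submodule.span_le (p := S.comap ((LinearMap.inr ℚ≥0 K (K × K)).comp
      (LinearMap.inr ℚ≥0 K K)))).mpr ?_ hx
    rintro _ ⟨g, hg, rfl⟩
    refine Submodule.subset_span ⟨_, hΓ₂ g hg, ?_⟩
    simp [squareCoeffs]
  have h3 : ∀ k, ((z k : K), ((integralBasis K).repr μ k : K) * integralBasis K k,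
      (z k : K) * integralBasis K k ^ 2) ∈ S := fun k => by
    rcases le_total 0 ((integralBasis K).repr μ k) with h | h
    · have := S.smul_mem (z k) (Submodule.subset_span ⟨_, hΓ₃ k, rfl⟩)
      convert this using 1
      simp [squareCoeffs, NNRat.smul_def, ← hzK, abs_of_nonneg h]
    · have := S.smul_mem (z k) (Submodule.subset_span ⟨_, hΓ₄ k, rfl⟩)
      convert this using 1
      simp [squareCoeffs, NNRat.smul_def, ← hzK, abs_of_nonpos h]
  have h4 := add_mem (add_mem (h1 _ ha) (h2 _ hc)) (sum_mem fun k (_ : k ∈ Finset.univ) => h3 k)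
  convert h4 using 1
  have h5 : μ = ∑ k, ((integralBasis K).repr μ k : K) * integralBasis K k := by
    conv_lhs => rw [← (integralBasis K).sum_repr μ]
    simp [Algebra.smul_def]
  ext
  · simp [Prod.fst_sum, hzK]
  · simpa [Prod.fst_sum, Prod.snd_sum] using h5
  · simp [Prod.snd_sum, hzK]

lemma exists_cone_triples (hK : TotallyReal K) {κ c₁ : ℝ} (hκ : 1 ≤ κ) (hc₁ : 1 ≤ c₁) :
    ∃ η : ℝ, 0 < η ∧ ∃ Γ : Set (𝓞 K × 𝓞 K × 𝓞 K), Γ.Finite ∧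
      (∀ γ ∈ Γ, ∀ s : K →+* ℝ, 0 < s γ.1) ∧ ∀ a μ e : K, (∀ s : K →+* ℝ, 0 < s a) →
        (∀ s : K →+* ℝ, 0 < s e) → (∀ s t : K →+* ℝ, s a ≤ κ * t a) →
        (∀ s t : K →+* ℝ, s e ≤ κ * t e) → (∀ s t : K →+* ℝ, s a ≤ c₁ * t e) →
        (∀ s : K →+* ℝ, |s μ| ≤ η * s a) →
        (a, μ, e + μ ^ 2 / a) ∈ Submodule.span ℚ≥0 (squareCoeffs '' Γ) := by
  obtain ⟨Ω, hΩ, hbd⟩ := exists_basis_bound (K := K)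
  obtain ⟨ρ, hρ, hcoord⟩ := hK.exists_coord_bound
  obtain ⟨G, hG, hGpos, hcone⟩ := hK.exists_cone_generators (κ := 4 * κ) (by linarith)
  let ι := Module.Free.ChooseBasisIndex ℤ (𝓞 K)
  have hω : ∀ (k : ι) (s : K →+* ℝ), s (integralBasis K k) ^ 2 ≤ Ω ^ 2 := fun k s => by
    classical
    have := hbd (Pi.single k 1) 1 zero_le_one (fun i => by
      rw [Pi.single_apply]; split_ifs <;> simp) s
    refine sq_le_sq.mpr (le_trans ?_ (le_abs_self Ω))
    simpa [Pi.single_apply] using this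
  set n : ℝ := (Fintype.card ι : ℝ) with hn
  have hn0 : 0 ≤ n := Nat.cast_nonneg _
  set q : ℝ := (n + 1) * (ρ + 1) * κ * Ω ^ 2 * c₁ with hq
  have hΩ2 : 1 ≤ Ω ^ 2 := one_le_pow₀ hΩ
  have hq1 : 0 < q := by positivity
  set η := 1 / (4 * q) with hη
  have hη0 : 0 < η := by positivity
  set τ := n * (ρ * (η * κ)) with hτ
  have hτ0 : 0 ≤ τ := by positivity
  have hqη : q * η = 1 / 4 := by rw [hη]; field_simp
  have hτΩ : Ω ^ 2 * τ * c₁ ≤ 1 / 4 := by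
    rw [← hqη, hτ, hq]
    calc Ω ^ 2 * (n * (ρ * (η * κ))) * c₁ = n * ρ * κ * Ω ^ 2 * c₁ * η := by ring
      _ ≤ (n + 1) * (ρ + 1) * κ * Ω ^ 2 * c₁ * η := by gcongr <;> linarith
  have hΩc : 1 ≤ Ω ^ 2 * c₁ := one_le_mul_of_one_le_of_one_le hΩ2 hc₁
  have hτ4 : τ ≤ 1 / 4 := by nlinarith
  have hηc : c₁ * η ≤ 1 / 4 := by
    rw [← hqη, hq]
    refine mul_le_mul_of_nonneg_right (le_mul_of_one_le_left (by linarith) ?_) hη0.le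
    have h1 : 1 ≤ (n + 1) * (ρ + 1) := by nlinarith
    exact one_le_mul_of_one_le_of_one_le (one_le_mul_of_one_le_of_one_le h1 hκ) hΩ2
  have hη1 : η ≤ 1 := by nlinarith
  have hηηc : η ^ 2 * c₁ ≤ 1 / 4 := by nlinarith
  refine ⟨η, hη0, (fun g => (g, 1, 0)) '' G ∪ (fun g => (g, 0, 1)) '' G ∪
    Set.range (fun k : ι => (1, 1, RingOfIntegers.basis K k)) ∪
    Set.range (fun k : ι => (1, 1, -RingOfIntegers.basis K k)),
    (((hG.image _).union (hG.image _)).union (Set.finite_range _)).union (Set.finite_range _),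
    ?_, fun a μ e ha he hba hbe hae hμ => ?_⟩
  · rintro _ (((⟨g, hg, rfl⟩ | ⟨g, hg, rfl⟩) | ⟨k, rfl⟩) | ⟨k, rfl⟩) s
    · exact hGpos g hg s
    · exact hGpos g hg s
    · simp
    · simp
  refine mem_cone_of_dominant (G := G) (fun g hg => .inl (.inl (.inl ⟨g, hg, rfl⟩)))
    (fun g hg => .inl (.inl (.inr ⟨g, hg, rfl⟩))) (fun k => .inl (.inr ⟨k, rfl⟩))
    (fun k => .inr ⟨k, rfl⟩) ?_ ?_
  all_goals
    set z : ι → ℚ := fun k => |(integralBasis K).repr μ k| with hz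
    have hz0 : ∀ k, (0 : ℝ) ≤ z k := fun k => by exact_mod_cast abs_nonneg _
    have hσ : ∀ s : K →+* ℝ, ∑ k, (z k : ℝ) ≤ τ * s a := fun s => by
      refine (Finset.sum_le_card_nsmul _ _ (ρ * (η * κ * s a)) fun k _ => ?_).trans_eq ?_
      · rw [hz]
        push_cast
        refine hcoord μ _ (fun t => (hμ t).trans ?_) k
        rw [mul_assoc]
        exact mul_le_mul_of_nonneg_left (hba t s) hη0.le
      · rw [Finset.card_univ, nsmul_eq_mul, hτ, ← hn]; ring
    have hσ0 : 0 ≤ ∑ k, (z k : ℝ) := Finset.sum_nonneg fun k _ => hz0 k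
  · have hval : ∀ s : K →+* ℝ, s (a - ∑ k, (z k : K)) = s a - ∑ k, (z k : ℝ) := fun s => by simp
    have hlow : ∀ s : K →+* ℝ, 3 / 4 * s a ≤ s (a - ∑ k, (z k : K)) := fun s => by
      rw [hval]
      nlinarith [hσ s, ha s]
    have hup : ∀ s : K →+* ℝ, s (a - ∑ k, (z k : K)) ≤ s a := fun s => by
      rw [hval]
      linarith
    refine hcone _ (fun s => lt_of_lt_of_le (by have := ha s; positivity) (hlow s)) fun s t => ?_
    nlinarith [hlow t, hup s, hba s t, ha t]
  · have hval : ∀ s : K →+* ℝ, s (e + μ ^ 2 / a - ∑ k, (z k : K) * integralBasis K k ^ 2) =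
        s e + s μ ^ 2 / s a - ∑ k, (z k : ℝ) * s (integralBasis K k) ^ 2 := fun s => by simp
    have h1 : ∀ s : K →+* ℝ, ∑ k, (z k : ℝ) * s (integralBasis K k) ^ 2 ≤ 1 / 4 * s e := fun s => by
      calc ∑ k, (z k : ℝ) * s (integralBasis K k) ^ 2 ≤ ∑ k, (z k : ℝ) * Ω ^ 2 :=
            Finset.sum_le_sum fun k _ => mul_le_mul_of_nonneg_left (hω k s) (hz0 k)
        _ = Ω ^ 2 * ∑ k, (z k : ℝ) := by rw [← Finset.sum_mul, mul_comm]
        _ ≤ Ω ^ 2 * (τ * (c₁ * s e)) := by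
            gcongr; exact (hσ s).trans (mul_le_mul_of_nonneg_left (hae s s) hτ0)
        _ = Ω ^ 2 * τ * c₁ * s e := by ring
        _ ≤ 1 / 4 * s e := mul_le_mul_of_nonneg_right hτΩ (he s).le
    have h2 : ∀ s : K →+* ℝ, 0 ≤ ∑ k, (z k : ℝ) * s (integralBasis K k) ^ 2 := fun s =>
      Finset.sum_nonneg fun k _ => mul_nonneg (hz0 k) (sq_nonneg _)
    have h3 : ∀ s : K →+* ℝ, s μ ^ 2 / s a ≤ 1 / 4 * s e := fun s => by
      have h := sq_le_sq.mpr ((hμ s).trans (le_abs_self _))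
      calc s μ ^ 2 / s a ≤ (η * s a) ^ 2 / s a := by
            have := (ha s).le
            gcongr
        _ = η ^ 2 * s a := by have := (ha s).ne'; field_simp
        _ ≤ η ^ 2 * (c₁ * s e) := by gcongr; exact hae s s
        _ = η ^ 2 * c₁ * s e := by ring
        _ ≤ 1 / 4 * s e := mul_le_mul_of_nonneg_right hηηc (he s).le
    have h4 : ∀ s : K →+* ℝ, 0 ≤ s μ ^ 2 / s a := fun s => div_nonneg (sq_nonneg _) (ha s).le
    refine hcone _ (fun s => ?_) fun s t => ?_
    · rw [hval]
      linarith [h1 s, h4 s, he s]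
    · rw [hval, hval]
      nlinarith [h1 t, h2 s, h3 s, h4 t, hbe s t, he t]

end TotallyReal

namespace OKLattice

variable {K : Type} [Field K]

lemma eq_zero_of_smul_add_smul (L : OKLattice K) {v w : L.carrier} (hv : v ≠ 0)
    (h : L.gram v w ≠ 0) {p q : 𝓞 K} (hpq : p • v + q • w = 0) : p = 0 ∧ q = 0 := by
  have h1 := L.gram_add_smul v w p q
  have hq : q = 0 := by
    rw [hpq] at h1
    have : q ^ 2 * L.gram v w = 0 := by rw [← h1]; simp [gram]
    simpa [h] using this
  rw [hq, zero_smul, add_zero] at hpq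
  exact ⟨(smul_eq_zero.mp hpq).resolve_right hv, hq⟩

lemma coords_left (L : OKLattice K) {v w : L.carrier} (hv : v ≠ 0) (h : L.gram v w ≠ 0)
    {H : 𝓞 K} {X Y : L.carrier →ₗ[𝓞 K] 𝓞 K} (hXY : ∀ x, H • x = X x • v + Y x • w) :
    X v = H ∧ Y v = 0 := by
  have h1 := hXY v
  have h2 := L.eq_zero_of_smul_add_smul hv h (p := X v - H) (q := Y v) (by
    rw [sub_smul, h1]; abel)
  exact ⟨sub_eq_zero.mp h2.1, h2.2⟩

lemma coords_right (L : OKLattice K) {v w : L.carrier} (hv : v ≠ 0) (h : L.gram v w ≠ 0)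
    {H : 𝓞 K} {X Y : L.carrier →ₗ[𝓞 K] 𝓞 K} (hXY : ∀ x, H • x = X x • v + Y x • w) :
    X w = 0 ∧ Y w = H := by
  have h1 := hXY w
  have h2 := L.eq_zero_of_smul_add_smul hv h (p := X w) (q := Y w - H) (by
    rw [sub_smul, h1]; abel)
  exact ⟨h2.1, sub_eq_zero.mp h2.2⟩

end OKLattice

namespace TotallyReal

variable {K : Type} [Field K] [NumberField K]

lemma exists_decomposition (hK : TotallyReal K) : ∃ H : ℕ, H ≠ 0 ∧
    ∃ Γ : Finset (𝓞 K × 𝓞 K × 𝓞 K), (∀ γ ∈ Γ, ∀ s : K →+* ℝ, 0 < s γ.1) ∧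
      ∀ L : OKLattice K, L.rank = 2 → ∃ X Y : L.carrier →ₗ[𝓞 K] 𝓞 K,
        (∃ n, X n = H ∧ Y n = 0) ∧ (∃ n, X n = 0 ∧ Y n = H) ∧ (∀ x, X x = 0 → Y x = 0 → x = 0) ∧
        ∃ t : 𝓞 K × 𝓞 K × 𝓞 K → ℚ≥0, ∀ x, (L.form x x : K) =
          ∑ γ ∈ Γ, (t γ : K) * (γ.1 * (γ.2.1 * X x + γ.2.2 * Y x) ^ 2 : 𝓞 K) := by
  obtain ⟨κ, c₁, hκ, hc₁, H₁, hH₁, hred⟩ := hK.exists_reduced_basis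
  obtain ⟨η, hη, Γ, hΓ, hΓpos, hcone⟩ := hK.exists_cone_triples hκ hc₁
  obtain ⟨T, hT1, hT⟩ := exists_multiple_near_integer (K := K) hη
  set H₂ := T.factorial with hH₂
  have hH₂0 : H₂ ≠ 0 := T.factorial_ne_zero
  refine ⟨H₁ * H₂ ^ 2, by positivity, hΓ.toFinset, fun γ hγ => hΓpos γ (by simpa using hγ),
    fun L hL => ?_⟩
  obtain ⟨v, w, X, Y, hv, hw, hexp, hba, hbe, hae⟩ := hred L hL
  obtain ⟨hXv, hYv⟩ := L.coords_left hv hw hexp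
  obtain ⟨hXw, hYw⟩ := L.coords_right hv hw hexp
  have hapos := L.posDef v hv
  have ha0 : L.form v v ≠ 0 := fun h => hv (L.eq_zero_of_form_self hK.nonempty_embedding h)
  have ha0' : (L.form v v : K) ≠ 0 := by simpa using ha0
  obtain ⟨r, hr1, hrT, o, ho⟩ := hT ((L.form v w : K) / L.form v v)
  obtain ⟨m, hm⟩ : r ∣ H₂ := Nat.dvd_factorial hr1 hrT
  have hr0 : (r : K) ≠ 0 := by exact_mod_cast (by omega : r ≠ 0)
  have hH₂K : (H₂ : K) ≠ 0 := by exact_mod_cast hH₂0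
  have hH₁K : (H₁ : K) ≠ 0 := by exact_mod_cast hH₁
  have hmK : (H₂ : K) = r * m := by exact_mod_cast hm
  set μ : K := L.form v w - (o : K) / r * L.form v v with hμ
  set e : K := (L.gram v w : K) / L.form v v with he
  have hmem := hcone (L.form v v) μ e hapos
    (fun s => by rw [he, map_div₀]; exact div_pos (L.gram_pos hw s) (hapos s)) hba hbe hae
    (fun s => by
      have h1 : μ = (r * ((L.form v w : K) / L.form v v) - o) * (L.form v v / r) := by
        rw [hμ]; field_simp
      have hr1' : (1 : ℝ) ≤ r := by exact_mod_cast hr1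
      have h2 : s ((L.form v v : K) / r) ≤ s (L.form v v) := by
        rw [map_div₀, map_natCast]
        exact div_le_self (hapos s).le hr1'
      have h3 : 0 ≤ s ((L.form v v : K) / r) := by
        rw [map_div₀, map_natCast]
        exact div_nonneg (hapos s).le (by linarith)
      rw [h1, map_mul, abs_mul, abs_of_nonneg h3]
      exact mul_le_mul (ho s) h2 h3 hη.le)
  rw [← hΓ.coe_toFinset, Submodule.mem_span_image_finset_iff_exists_fun'] at hmem
  obtain ⟨t, ht⟩ := hmem
  have hta := congrArg (fun z => z.1) ht
  have htb := congrArg (fun z => z.2.1) ht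
  have htc := congrArg (fun z => z.2.2) ht
  simp only [Prod.fst_sum, Prod.snd_sum, Prod.smul_fst, Prod.smul_snd, squareCoeffs,
    NNRat.smul_def] at hta htb htc
  refine ⟨(H₂ : 𝓞 K) • X + ((m : 𝓞 K) * o) • Y, (H₂ : 𝓞 K) • Y, ⟨(H₂ : 𝓞 K) • v, ?_, ?_⟩,
    ⟨(H₂ : 𝓞 K) • w - ((m : 𝓞 K) * o) • v, ?_, ?_⟩, fun x hx hy => ?_,
    fun γ => t γ / ((H₁ : ℚ≥0) * H₂) ^ 2, fun x => ?_⟩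
  · simp [hXv, hYv]; ring
  · simp [hYv]
  · simp [hXv, hYv, hXw, hYw]; ring
  · simp [hYv, hYw]; ring
  · have hH₂O : (H₂ : 𝓞 K) ≠ 0 := by exact_mod_cast hH₂0
    have hH₁O : (H₁ : 𝓞 K) ≠ 0 := by exact_mod_cast hH₁
    have hy' : Y x = 0 := by simpa [hH₂0] using hy
    have hx' : X x = 0 := by simpa [hH₂0, hy'] using hx
    have := hexp x
    rw [hx', hy', zero_smul, zero_smul, add_zero] at this
    exact (smul_eq_zero.mp this).resolve_left hH₁O
  · have h1 : (H₁ : 𝓞 K) ^ 2 * L.form x x = L.form v v * X x ^ 2 + 2 * L.form v w * X x * Y x +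
        L.form w w * Y x ^ 2 := by
      have := congrArg (fun z => L.form z z) (hexp x)
      simp only [map_add, LinearMap.add_apply, L.form_smul_left, L.form_smul_right,
        L.symm w v] at this
      linear_combination this
    have h2 := congrArg (algebraMap (𝓞 K) K) h1
    simp only [map_mul, map_add, map_pow, map_natCast, map_ofNat] at h2
    set x₁ : K := H₂ * X x + m * o * Y x with hx₁
    set y₁ : K := H₂ * Y x with hy₁
    have h3 : ∀ γ ∈ hΓ.toFinset, ((t γ / ((H₁ : ℚ≥0) * H₂) ^ 2 : ℚ≥0) : K) *
        ((γ.1 * (γ.2.1 * ((H₂ : 𝓞 K) • X + ((m : 𝓞 K) * o) • Y) x +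
          γ.2.2 * ((H₂ : 𝓞 K) • Y) x) ^ 2 : 𝓞 K) : K) = 1 / ((H₁ : K) * H₂) ^ 2 *
        ((t γ : K) * ((γ.1 : K) * γ.2.1 ^ 2) * x₁ ^ 2 +
          (t γ : K) * ((γ.1 : K) * γ.2.1 * γ.2.2) * (2 * x₁ * y₁) +
          (t γ : K) * ((γ.1 : K) * γ.2.2 ^ 2) * y₁ ^ 2) := fun γ _ => by
      simp only [LinearMap.add_apply, LinearMap.smul_apply, smul_eq_mul, map_mul, map_add, map_pow,
        map_natCast, NNRat.cast_div, NNRat.cast_pow, NNRat.cast_mul, NNRat.cast_natCast, hx₁, hy₁]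
      ring
    rw [Finset.sum_congr rfl h3, ← Finset.mul_sum, Finset.sum_add_distrib, Finset.sum_add_distrib,
      ← Finset.sum_mul, ← Finset.sum_mul, ← Finset.sum_mul, hta, htb, htc, hμ, he, hx₁, hy₁]
    simp only [OKLattice.gram, map_sub, map_mul, map_pow, hmK]
    rw [hmK] at hH₂K
    have hm0 : (m : K) ≠ 0 := right_ne_zero_of_mul hH₂K
    field_simp
    linear_combination (r : K) ^ 2 * (L.form v v : K) * h2

end TotallyReal

namespace OKLattice

variable {K : Type} [Field K]

lemma form_of_coords {H : ℕ} (L : OKLattice K) {X Y : L.carrier →ₗ[𝓞 K] 𝓞 K} {v w : L.carrier}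
    (hXv : X v = H) (hYv : Y v = 0) (hXw : X w = 0) (hYw : Y w = H)
    (hinj : ∀ x, X x = 0 → Y x = 0 → x = 0) (x : L.carrier) :
    (H : 𝓞 K) ^ 2 * L.form x x =
      X x ^ 2 * L.form v v + 2 * X x * Y x * L.form v w + Y x ^ 2 * L.form w w := by
  have h1 : (H : 𝓞 K) • x = X x • v + Y x • w := by
    rw [← sub_eq_zero]
    refine hinj _ ?_ ?_
    · simp only [map_sub, map_add, map_smul, hXv, hXw, smul_eq_mul]; ring
    · simp only [map_sub, map_add, map_smul, hYv, hYw, smul_eq_mul]; ring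
  have h2 := congrArg (fun z => L.form z z) h1
  simp only [map_add, LinearMap.add_apply, L.form_smul_left, L.form_smul_right, L.symm w v] at h2
  linear_combination h2

variable [NumberField K]

lemma form_eq_sum_of_diag {ι : Type} (N : OKLattice K) (Γ : Finset ι) (β : ι → 𝓞 K)
    (ℓ : ι → N.carrier →ₗ[𝓞 K] 𝓞 K) (t : ι → ℚ≥0)
    (h : ∀ x, (N.form x x : K) = ∑ γ ∈ Γ, (t γ : K) * (β γ * ℓ γ x ^ 2 : 𝓞 K)) (x y : N.carrier) :
    (N.form x y : K) = ∑ γ ∈ Γ, (t γ : K) * (β γ * ℓ γ x * ℓ γ y : 𝓞 K) := by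
  have hxy := h (x + y)
  have h2 : ((2 : 𝓞 K) * N.form x y : 𝓞 K) = N.form (x + y) (x + y) - N.form x x - N.form y y := by
    simp only [map_add, LinearMap.add_apply, N.symm y x]
    ring
  have h3 : (2 : K) * N.form x y =
      (N.form (x + y) (x + y) : K) - N.form x x - N.form y y := by
    have := congrArg (algebraMap (𝓞 K) K) h2
    simp only [map_mul, map_ofNat, map_sub] at this
    exact this
  rw [hxy, h x, h y, ← Finset.sum_sub_distrib, ← Finset.sum_sub_distrib] at h3
  refine mul_left_cancel₀ (two_ne_zero (α := K)) (h3.trans ?_)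
  rw [Finset.mul_sum]
  refine Finset.sum_congr rfl fun γ _ => ?_
  simp only [map_add, map_mul, map_pow]
  ring

/-- A form which is a nonnegative rational combination of squares splits into an integral
combination of the same squares and a positive definite remainder with bounded coefficients. -/
lemma exists_remainder {ι : Type} (hs : Nonempty (K →+* ℝ)) (N : OKLattice K) (Γ : Finset ι)
    (β : ι → 𝓞 K) (hβ : ∀ γ ∈ Γ, ∀ s : K →+* ℝ, 0 < s (β γ))
    (ℓ : ι → N.carrier →ₗ[𝓞 K] 𝓞 K) (t : ι → ℚ≥0)
    (h : ∀ x, (N.form x x : K) = ∑ γ ∈ Γ, (t γ : K) * (β γ * ℓ γ x ^ 2 : 𝓞 K)) :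
    ∃ n : ι → ℕ, ∃ u : ι → ℚ≥0, (∀ γ, u γ ≤ 1) ∧
      ∃ f : N.carrier →ₗ[𝓞 K] N.carrier →ₗ[𝓞 K] 𝓞 K, (∀ x y, f x y = f y x) ∧
        (∀ x, x ≠ 0 → ∀ s : K →+* ℝ, 0 < s (algebraMap (𝓞 K) K (f x x))) ∧
        (∀ x, N.form x x = ∑ γ ∈ Γ, (n γ : 𝓞 K) * (β γ * ℓ γ x ^ 2) + f x x) ∧
        ∀ x y, (f x y : K) = ∑ γ ∈ Γ, (u γ : K) * (β γ * ℓ γ x * ℓ γ y : 𝓞 K) := by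
  have hu : ∀ q : ℚ≥0, ∃ n : ℕ, ∃ u : ℚ≥0, u ≤ 1 ∧ q = n + u ∧ (u = 0 → q = 0) := fun q => by
    refine ⟨⌈q⌉₊ - 1, q - (⌈q⌉₊ - 1 : ℕ), ?_, ?_, fun h0 => ?_⟩
    · rw [tsub_le_iff_right]
      exact (Nat.le_ceil q).trans (by exact_mod_cast (by omega : ⌈q⌉₊ ≤ 1 + (⌈q⌉₊ - 1)))
    · rw [add_tsub_cancel_of_le]
      rcases Nat.eq_zero_or_pos ⌈q⌉₊ with h1 | h1
      · simp [h1]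
      · exact (Nat.lt_ceil.mp (by omega)).le
    · by_contra hq
      have h1 : 0 < ⌈q⌉₊ := Nat.ceil_pos.mpr (pos_iff_ne_zero.mpr hq)
      have h2 : ((⌈q⌉₊ - 1 : ℕ) : ℚ≥0) < q := Nat.lt_ceil.mp (by omega)
      exact (tsub_pos_of_lt h2).ne' h0
  choose n u hu1 hnu hu0 using fun γ => hu (t γ)
  have hsum : ∀ x y, ((N.form - ∑ γ ∈ Γ, ((n γ : 𝓞 K) * β γ) •
      (LinearMap.mul (𝓞 K) (𝓞 K)).compl₁₂ (ℓ γ) (ℓ γ)) x y : 𝓞 K) =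
      N.form x y - ∑ γ ∈ Γ, (n γ : 𝓞 K) * (β γ * ℓ γ x * ℓ γ y) := fun x y => by
    simp [mul_assoc]
  have hf : ∀ x y, (((N.form - ∑ γ ∈ Γ, ((n γ : 𝓞 K) * β γ) •
      (LinearMap.mul (𝓞 K) (𝓞 K)).compl₁₂ (ℓ γ) (ℓ γ)) x y : 𝓞 K) : K) =
      ∑ γ ∈ Γ, (u γ : K) * (β γ * ℓ γ x * ℓ γ y : 𝓞 K) := fun x y => by
    have h1 := N.form_eq_sum_of_diag Γ β ℓ t h x y
    simp only [hsum, map_sub, map_sum]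
    refine (congrArg (· - _) h1).trans ?_
    rw [← Finset.sum_sub_distrib]
    refine Finset.sum_congr rfl fun γ _ => ?_
    simp only [hnu γ, map_mul, map_natCast, NNRat.cast_add, NNRat.cast_natCast]
    ring
  refine ⟨n, u, hu1, _, fun x y => ?_, fun x hx s => ?_, fun x => ?_, hf⟩
  · rw [hsum, hsum, N.symm y x]
    exact congrArg _ (Finset.sum_congr rfl fun γ _ => by ring)
  · refine (congrArg s (hf x x)).symm ▸ ?_
    rw [map_sum]
    have hterm : ∀ γ ∈ Γ, 0 ≤ s ((u γ : K) * (β γ * ℓ γ x * ℓ γ x : 𝓞 K)) := fun γ hγ => by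
      simp only [map_mul, map_nnratCast, mul_assoc]
      exact mul_nonneg (NNRat.cast_nonneg _) (mul_nonneg (hβ γ hγ s).le (mul_self_nonneg _))
    refine (Finset.sum_nonneg hterm).lt_of_ne' fun h0 => hx ?_
    rw [Finset.sum_eq_zero_iff_of_nonneg hterm] at h0
    refine N.eq_zero_of_form_self hs ?_
    have : (N.form x x : K) = 0 := by
      rw [h]
      refine Finset.sum_eq_zero fun γ hγ => ?_
      rcases mul_eq_zero.mp ((map_eq_zero s).mp (h0 γ hγ)) with h1 | h1
      · rw [hu0 γ (by exact_mod_cast h1)]; simp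
      · rw [pow_two, ← mul_assoc, h1, mul_zero]
    simpa using this
  · rw [hsum, show ∑ γ ∈ Γ, (n γ : 𝓞 K) * (β γ * ℓ γ x * ℓ γ x) =
      ∑ γ ∈ Γ, (n γ : 𝓞 K) * (β γ * ℓ γ x ^ 2) from
        Finset.sum_congr rfl fun γ _ => by ring]
    ring

/-- The data `k` determine a binary lattice up to isometry: the image modulo `H` of a coordinate
system with denominator `H`, and the Gram matrix of the vectors with coordinates `(H, 0)` and
`(0, H)`. -/
def HasKey (H : ℕ) (L : OKLattice K)
    (k : Set ((𝓞 K ⧸ Ideal.span {(H : 𝓞 K)}) × (𝓞 K ⧸ Ideal.span {(H : 𝓞 K)})) ×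
      𝓞 K × 𝓞 K × 𝓞 K) : Prop :=
  ∃ X Y : L.carrier →ₗ[𝓞 K] 𝓞 K, ∃ v w : L.carrier, X v = H ∧ Y v = 0 ∧ X w = 0 ∧ Y w = H ∧
    (∀ x, X x = 0 → Y x = 0 → x = 0) ∧
    k.1 = Set.range (fun x => (Ideal.Quotient.mk _ (X x), Ideal.Quotient.mk _ (Y x))) ∧
    k.2 = (L.form v v, L.form v w, L.form w w)

lemma represents_of_hasKey {H : ℕ} (hH : H ≠ 0) {L L' : OKLattice K} {k}
    (h : L.HasKey H k) (h' : L'.HasKey H k) : L.Represents L' := by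
  obtain ⟨X, Y, v, w, hXv, hYv, hXw, hYw, hinj, hr, hk⟩ := h
  obtain ⟨X', Y', v', w', hXv', hYv', hXw', hYw', hinj', hr', hk'⟩ := h'
  have hφ : Function.Injective (X.prod Y) := by
    rw [injective_iff_map_eq_zero]
    intro x hx
    exact hinj x (congrArg Prod.fst hx) (congrArg Prod.snd hx)
  have hmem : ∀ x, (X'.prod Y') x ∈ (X.prod Y).range := fun x => by
    have : (Ideal.Quotient.mk (Ideal.span {(H : 𝓞 K)}) (X' x),
        Ideal.Quotient.mk (Ideal.span {(H : 𝓞 K)}) (Y' x)) ∈ k.1 := hr' ▸ ⟨x, rfl⟩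
    rw [hr] at this
    obtain ⟨z, hz⟩ := this
    simp only [Prod.mk.injEq, Ideal.Quotient.eq, Ideal.mem_span_singleton] at hz
    obtain ⟨⟨a, ha⟩, b, hb⟩ := hz
    refine ⟨z - a • v - b • w, ?_⟩
    refine Prod.ext ?_ ?_
    · change X _ = X' x
      simp only [map_sub, map_smul, hXv, hXw, smul_eq_mul]
      linear_combination ha
    · change Y _ = Y' x
      simp only [map_sub, map_smul, hYv, hYw, smul_eq_mul]
      linear_combination hb
  let σ : L'.carrier →ₗ[𝓞 K] L.carrier :=
    (LinearEquiv.ofInjective _ hφ).symm.toLinearMap ∘ₗ (X'.prod Y').codRestrict _ hmem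
  have hσ : ∀ x, (X.prod Y) (σ x) = (X'.prod Y') x := fun x =>
    LinearEquiv.ofInjective_symm_apply (X.prod Y) (h := hφ) _
  refine ⟨σ, fun x => ?_⟩
  have hX : X (σ x) = X' x := congrArg Prod.fst (hσ x)
  have hY : Y (σ x) = Y' x := congrArg Prod.snd (hσ x)
  have h1 := L.form_of_coords hXv hYv hXw hYw hinj (σ x)
  have h2 := L'.form_of_coords hXv' hYv' hXw' hYw' hinj' x
  rw [hk] at hk'
  simp only [Prod.mk.injEq] at hk'
  rw [hX, hY, hk'.1, hk'.2.1, hk'.2.2, ← h2] at h1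
  exact mul_left_cancel₀ (pow_ne_zero 2 (by exact_mod_cast hH)) h1

end OKLattice

namespace TotallyReal

variable {K : Type} [Field K] [NumberField K]

lemma finite_bounded_combinations {ι : Type} (hK : TotallyReal K) (Γ : Finset ι) (g : ι → 𝓞 K) :
    {z : 𝓞 K | ∃ u : ι → ℚ≥0, (∀ γ, u γ ≤ 1) ∧ (z : K) = ∑ γ ∈ Γ, (u γ : K) * g γ}.Finite := by
  refine (hK.finite_bounded_integers (∑ γ ∈ Γ, ∑ s : K →+* ℝ, |s (g γ)|)).subset ?_
  rintro z ⟨u, hu, hz⟩ s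
  rw [hz, map_sum]
  refine (Finset.abs_sum_le_sum_abs _ _).trans (Finset.sum_le_sum fun γ _ => ?_)
  rw [map_mul, map_nnratCast, abs_mul, abs_of_nonneg (NNRat.cast_nonneg _)]
  have h1 : ((u γ : ℚ≥0) : ℝ) ≤ 1 := by exact_mod_cast hu γ
  exact (mul_le_of_le_one_left (abs_nonneg _) h1).trans
    (Finset.single_le_sum (f := fun s : K →+* ℝ => |s (g γ)|) (fun _ _ => abs_nonneg _)
      (Finset.mem_univ s))

lemma exists_universal (hK : TotallyReal K) : ∃ L : OKLattice K, L.IsUniversal 2 := by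
  classical
  obtain ⟨H, hH, Γ, hΓ, hdec⟩ := hK.exists_decomposition
  have hI : Ideal.span {(H : 𝓞 K)} ≠ ⊥ := by simpa using hH
  have := Ideal.finiteQuotientOfFreeOfNeBot _ hI
  set F₁₁ := {z : 𝓞 K | ∃ u : 𝓞 K × 𝓞 K × 𝓞 K → ℚ≥0, (∀ γ, u γ ≤ 1) ∧
    (z : K) = ∑ γ ∈ Γ, (u γ : K) * (γ.1 * (γ.2.1 * H) * (γ.2.1 * H) : 𝓞 K)}
  set F₁₂ := {z : 𝓞 K | ∃ u : 𝓞 K × 𝓞 K × 𝓞 K → ℚ≥0, (∀ γ, u γ ≤ 1) ∧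
    (z : K) = ∑ γ ∈ Γ, (u γ : K) * (γ.1 * (γ.2.1 * H) * (γ.2.2 * H) : 𝓞 K)}
  set F₂₂ := {z : 𝓞 K | ∃ u : 𝓞 K × 𝓞 K × 𝓞 K → ℚ≥0, (∀ γ, u γ ≤ 1) ∧
    (z : K) = ∑ γ ∈ Γ, (u γ : K) * (γ.1 * (γ.2.2 * H) * (γ.2.2 * H) : 𝓞 K)}
  let S : Set (Set ((𝓞 K ⧸ Ideal.span {(H : 𝓞 K)}) × (𝓞 K ⧸ Ideal.span {(H : 𝓞 K)})) ×
      𝓞 K × 𝓞 K × 𝓞 K) := Set.univ ×ˢ F₁₁ ×ˢ F₁₂ ×ˢ F₂₂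
  have hS : S.Finite := Set.finite_univ.prod ((hK.finite_bounded_combinations Γ _).prod
    ((hK.finite_bounded_combinations Γ _).prod (hK.finite_bounded_combinations Γ _)))
  let A := {k | k ∈ S ∧ ∃ R : OKLattice K, R.HasKey H k}
  have hA : Finite A := (hS.subset fun k hk => hk.1).to_subtype
  have := Fintype.ofFinite A
  choose R hR using fun k : A => k.2.2
  refine ⟨OKLattice.directSum (Sum.elim (fun p : Γ × Fin 4 => OKLattice.unary p.1.1.1 (hΓ _ p.1.2)) R),
    fun N hN => ?_⟩
  obtain ⟨X, Y, ⟨v, hXv, hYv⟩, ⟨w, hXw, hYw⟩, hinj, t, ht⟩ := hdec N hN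
  obtain ⟨n, u, hu, f, hfs, hfp, hNf, hfu⟩ := N.exists_remainder hK.nonempty_embedding Γ
    (fun γ => γ.1) hΓ (fun γ => γ.2.1 • X + γ.2.2 • Y) t (fun x => by simpa using ht x)
  let N' : OKLattice K := { carrier := N.carrier, form := f, symm := hfs, posDef := hfp }
  set k₀ := ((Set.range fun x => (Ideal.Quotient.mk (Ideal.span {(H : 𝓞 K)}) (X x),
    Ideal.Quotient.mk (Ideal.span {(H : 𝓞 K)}) (Y x))), f v v, f v w, f w w)
  have hkey : N'.HasKey H k₀ := ⟨X, Y, v, w, hXv, hYv, hXw, hYw, hinj, rfl, rfl⟩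
  have hmem : k₀ ∈ S := by
    refine ⟨Set.mem_univ _, ⟨u, hu, ?_⟩, ⟨u, hu, ?_⟩, ⟨u, hu, ?_⟩⟩ <;>
    · refine (hfu _ _).trans (Finset.sum_congr rfl fun γ _ => ?_)
      simp [hXv, hYv, hXw, hYw]
  have hτ : ∀ k : A, ∃ τ : N.carrier →ₗ[𝓞 K] (R k).carrier,
      ∀ x, (R k).form (τ x) (τ x) = if k = ⟨k₀, hmem, N', hkey⟩ then f x x else 0 := fun k => by
    split_ifs with h
    · have h1 := hR k
      rw [h] at h1
      rw [h]
      exact OKLattice.represents_of_hasKey hH h1 hkey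
    · exact ⟨0, fun x => by simp⟩
  choose τ hτ using hτ
  have hsq : ∀ m : ℕ, ∃ a : Fin 4 → ℕ, ∑ i, a i ^ 2 = m := fun m => by
    obtain ⟨a, b, c, d, h⟩ := m.sum_four_squares
    exact ⟨![a, b, c, d], by simpa [Fin.sum_univ_four] using h⟩
  choose a ha using hsq
  refine OKLattice.directSum_represents _ N (fun i => match i with
    | Sum.inl p => (a (n p.1) p.2 : 𝓞 K) • (p.1.1.2.1 • X + p.1.1.2.2 • Y)
    | Sum.inr k => τ k) fun x => ?_
  rw [Fintype.sum_sum_type, hNf x]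
  refine congrArg₂ (· + ·) ?_ ?_
  · rw [Fintype.sum_prod_type]
    refine Eq.trans ?_ (Finset.sum_coe_sort Γ
      fun γ => (n γ : 𝓞 K) * (γ.1 * (γ.2.1 • X + γ.2.2 • Y) x ^ 2))
    refine Finset.sum_congr rfl fun γ _ => ?_
    rw [← ha (n γ), Nat.cast_sum, Finset.sum_mul]
    refine Finset.sum_congr rfl fun i _ => ?_
    change γ.1.1 * ((a (n γ) i : 𝓞 K) * (γ.1.2.1 * X x + γ.1.2.2 * Y x) *
      ((a (n γ) i : 𝓞 K) * (γ.1.2.1 * X x + γ.1.2.2 * Y x))) = ((a (n γ) i ^ 2 : ℕ) : 𝓞 K) *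
      (γ.1.1 * (γ.1.2.1 * X x + γ.1.2.2 * Y x) ^ 2)
    push_cast
    ring
  · exact (Finset.sum_congr rfl fun k _ => hτ k x).trans (by simp)

end TotallyReal

theorem stmt5 (C : ℝ) (hC : 0 < C) (d : ℕ) (hd : 1 ≤ d) :
    {K : Subfield ℝ |
      FiniteDimensional ℚ K ∧ TotallyReal K ∧ Module.finrank ℚ K = d ∧
        (minUnivRank K 2 : ℝ) < C}.Finite := by
  exact TotallyReal.finite_of_exists_universal (fun _ _ _ hK => hK.exists_universal) C d
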